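/- arXiv:1605.08538 — 3 statements merged into one kernel-verified Lean document; each statement's English description precedes it below -/
import Mathlib

section
/- Let d ∈ ℕ with d ≥ 3. The number of subsets V ⊆ {0,1}^d such that the polytope conv(V) satisfies sxc(conv(V)) ≤ 2^{d/4}/(3·√d) is at most 2^{2^d}·2^{−2^{d−1}}. Equivalently, if P is a 0/1-polytope chosen uniformly at random among all 2^{2^d} 0/1-polytopes in ℝ^d, then Prob(sxc(P) ≤ 2^{d/4}/(3·√d)) ≤ 2^{−2^{d−1}}. -/
open Metric Set

noncomputable section

/-- A polytope: convex hull of a finite set. -/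
def IsPolytope {d : ℕ} (P : Set (EuclideanSpace ℝ (Fin d))) : Prop :=
  ∃ V : Finset (EuclideanSpace ℝ (Fin d)), P = convexHull ℝ (V : Set (EuclideanSpace ℝ (Fin d)))

/-- `P` has an extended formulation with `l` LMIs of size `m`. -/
def HasSdpExtBlocks {d : ℕ} (P : Set (EuclideanSpace ℝ (Fin d))) (l m : ℕ) : Prop :=
  ∃ (n : ℕ) (φ : EuclideanSpace ℝ (Fin n) →ᵃ[ℝ] EuclideanSpace ℝ (Fin d))
    (M : Fin l → (EuclideanSpace ℝ (Fin n) →ᵃ[ℝ] Matrix (Fin m) (Fin m) ℝ)),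
    (∀ i x, (M i x).IsSymm) ∧ P = φ '' {x | ∀ i, (M i x).PosSemidef}

/-- `P` has an extended formulation with a single LMI of size `k`. -/
def HasSdpExt {d : ℕ} (P : Set (EuclideanSpace ℝ (Fin d))) (k : ℕ) : Prop :=
  ∃ (n : ℕ) (φ : EuclideanSpace ℝ (Fin n) →ᵃ[ℝ] EuclideanSpace ℝ (Fin d))
    (M : EuclideanSpace ℝ (Fin n) →ᵃ[ℝ] Matrix (Fin k) (Fin k) ℝ),
    (∀ x, (M x).IsSymm) ∧ P = φ '' {x | (M x).PosSemidef}

/-- `P` has an extended formulation with `l` linear inequalities. -/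
def HasLinExt {d : ℕ} (P : Set (EuclideanSpace ℝ (Fin d))) (l : ℕ) : Prop :=
  ∃ (n : ℕ) (φ : EuclideanSpace ℝ (Fin n) →ᵃ[ℝ] EuclideanSpace ℝ (Fin d))
    (a : Fin l → (EuclideanSpace ℝ (Fin n) →ᵃ[ℝ] ℝ)),
    P = φ '' {x | ∀ i, 0 ≤ a i x}

open Classical in
/-- Semidefinite extension complexity. -/
def sxc {d : ℕ} (P : Set (EuclideanSpace ℝ (Fin d))) : ℕ :=
  if P = ∅ ∨ ∃ p, P = {p} then 0 else sInf {k | HasSdpExt P k}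

open Classical in
/-- Linear extension complexity. -/
def xc {d : ℕ} (P : Set (EuclideanSpace ℝ (Fin d))) : ℕ :=
  if P = ∅ ∨ ∃ p, P = {p} then 0 else sInf {l | HasLinExt P l}

/-- Spectral norm of a square real matrix (the operator norm of the induced map
on Euclidean space; for a symmetric matrix this is the largest absolute value of
an eigenvalue). -/
def specNorm {ι : Type*} [Fintype ι] [DecidableEq ι] (T : Matrix ι ι ℝ) : ℝ :=
  ‖LinearMap.toContinuousLinearMap (Matrix.toEuclideanLin T)‖

/-- Norm of a linear map into square matrices: the maximum of the spectral norm
of the values over the unit ball. -/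
def lmNorm {n : ℕ} {ι : Type*} [Fintype ι] [DecidableEq ι]
    (A : EuclideanSpace ℝ (Fin n) →ₗ[ℝ] Matrix ι ι ℝ) : ℝ :=
  sSup {r | ∃ x : EuclideanSpace ℝ (Fin n), ‖x‖ ≤ 1 ∧ r = specNorm (A x)}

/-- A 0/1-polytope: the convex hull of a set of 0/1-vectors. -/
def IsZeroOnePolytope {d : ℕ} (P : Set (EuclideanSpace ℝ (Fin d))) : Prop :=
  ∃ V : Set (EuclideanSpace ℝ (Fin d)),
    V ⊆ {x | ∀ i, x i = 0 ∨ x i = 1} ∧ P = convexHull ℝ V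


section MatrixPart

open Matrix

lemma psd_entry_sq {ι : Type*} [Fintype ι] [DecidableEq ι] {W : Matrix ι ι ℝ} (h : W.PosSemidef) (a b : ι) :
    W a b ^ 2 ≤ W a a * W b b := by
  obtain ⟨B, rfl⟩ : ∃ B : Matrix ι ι ℝ, W = Bᴴ * B := by
    open scoped MatrixOrder in
    exact CStarAlgebra.nonneg_iff_eq_star_mul_self.mp h.nonneg
  simp only [Matrix.mul_apply, conjTranspose_apply, star_trivial]
  have := Finset.sum_mul_sq_le_sq_mul_sq Finset.univ (fun c => B c a) (fun c => B c b)
  simpa [pow_two] using this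

lemma psd_pert {K : ℕ} {Z : Matrix (Fin K) (Fin K) ℝ} (hs : Z.IsHermitian) (η : ℝ)
    (h : ∀ a b, |Z a b| ≤ η) : (Z + ((K : ℝ) * η) • (1 : Matrix (Fin K) (Fin K) ℝ)).PosSemidef := by
  refine PosSemidef.of_dotProduct_mulVec_nonneg ?_ ?_
  · refine hs.add ?_
    simp [IsHermitian, conjTranspose_smul]
  · intro x
    rw [add_mulVec, dotProduct_add, smul_mulVec, one_mulVec, dotProduct_smul]
    have h1 : -(∑ a, ∑ b, η * (|x a| * |x b|)) ≤ star x ⬝ᵥ Z *ᵥ x := by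
      simp only [dotProduct, mulVec, star_trivial, Pi.star_apply, Finset.mul_sum, ← Finset.sum_neg_distrib]
      refine Finset.sum_le_sum fun a _ => Finset.sum_le_sum fun b _ => ?_
      have : |x a * (Z a b * x b)| ≤ η * (|x a| * |x b|) := by
        rw [abs_mul, abs_mul]
        have := mul_le_mul_of_nonneg_right (h a b) (mul_nonneg (abs_nonneg (x a)) (abs_nonneg (x b)))
        linarith
      exact (abs_le.mp this).1
    have h2 : ∑ a, ∑ b, η * (|x a| * |x b|) = η * (∑ a, |x a|) ^ 2 := by
      rw [pow_two, Finset.sum_mul_sum]; simp [Finset.mul_sum]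
    have h3 : (∑ a, |x a|) ^ 2 ≤ (K : ℝ) * ∑ a, x a ^ 2 := by
      have := sq_sum_le_card_mul_sum_sq (s := (Finset.univ : Finset (Fin K))) (f := fun a => |x a|)
      simpa using this
    have h4 : star x ⬝ᵥ x = ∑ a, x a ^ 2 := by simp [dotProduct, pow_two]
    rw [h4, smul_eq_mul]
    rcases Nat.eq_zero_or_pos K with rfl | hK
    · simp [dotProduct]
    have hη : 0 ≤ η := (abs_nonneg _).trans (h ⟨0, hK⟩ ⟨0, hK⟩)
    have := mul_le_mul_of_nonneg_left h3 hη
    rw [h2] at h1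
    nlinarith

lemma spanner {ι W : Type*} [AddCommGroup W] [Module ℝ W] [FiniteDimensional ℝ W]
    (f : ι → W) (S : Set ι) (hS : S.Finite) (hne : S.Nonempty) (N : ℕ) (hN : Module.finrank ℝ W ≤ N) :
    ∃ e : Fin N → ι, (∀ j, e j ∈ S) ∧ ∀ v ∈ S, ∃ l : Fin N → ℝ, (∀ j, |l j| ≤ 1) ∧
      f v = ∑ j, l j • f (e j) := by
  classical
  set E := Submodule.span ℝ (f '' S) with hE
  set r := Module.finrank ℝ E with hr
  have hrN : r ≤ N := (Submodule.finrank_le E).trans hN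
  let b : Module.Basis (Fin r) ℝ E := Module.finBasis ℝ E
  let g : S → E := fun s => ⟨f s, Submodule.subset_span ⟨s, s.2, rfl⟩⟩
  have hg : Submodule.span ℝ (Set.range g) = ⊤ := by
    have : Set.range g = ((↑) : E → W) ⁻¹' (f '' S) := by
      ext ⟨x, hx⟩; simp [g, Subtype.ext_iff]
    rw [this]
    exact Submodule.span_span_coe_preimage
  have : Finite S := hS
  -- a tuple with nonzero determinant
  have hex : ∃ t : Fin r → S, b.det (g ∘ t) ≠ 0 := by
    by_contra! hall
    have h0 : b.det = 0 := by
      obtain ⟨κ, a, ha1, ha2, ha3⟩ := exists_linearIndependent' ℝ g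
      let c : Module.Basis κ ℝ E := Module.Basis.mk ha3 (by rw [ha2, hg])
      have : Fintype κ := FiniteDimensional.fintypeBasisIndex c
      have hcard : Fintype.card κ = r := by rw [hr, Module.finrank_eq_card_basis c]
      let eq : Fin r ≃ κ := (Fintype.equivFinOfCardEq hcard).symm
      exfalso
      have := (b.isUnit_det (c.reindex eq.symm)).ne_zero
      apply this
      rw [← hall (a ∘ eq)]
      congr 1
      ext j
      simp [c]
    have := b.det_self
    rw [h0] at this
    simp at this
  have : Nonempty (Fin r → S) := ⟨hex.choose⟩
  obtain ⟨t, ht⟩ := Finite.exists_max (fun t : Fin r → S => |b.det (g ∘ t)|)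
  have hpos : b.det (g ∘ t) ≠ 0 := by
    obtain ⟨u, hu⟩ := hex
    have := (abs_pos.mpr hu).trans_le (ht u)
    exact abs_pos.mp this
  obtain ⟨hli, hsp⟩ := (Module.Basis.is_basis_iff_det b).mpr (isUnit_iff_ne_zero.mpr hpos)
  let c : Module.Basis (Fin r) ℝ E := Module.Basis.mk hli hsp.ge
  have hc : ∀ j, c j = g (t j) := fun j => by simp [c]
  have key : ∀ (v : S) (j : Fin r), |c.repr (g v) j| ≤ 1 := by
    intro v j
    have h1 : b.det (Function.update (g ∘ t) j (g v)) = c.repr (g v) j * b.det (g ∘ t) := by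
      have h0 : b.det (Function.update (g ∘ t) j (g v)) =
          b.det (Function.update (g ∘ t) j (∑ i, c.repr (g v) i • c i)) := by
        rw [c.sum_repr (g v)]
      rw [h0, AlternatingMap.map_update_sum]
      rw [Finset.sum_eq_single j]
      · rw [AlternatingMap.map_update_smul, hc]
        have : Function.update (g ∘ t) j (g (t j)) = g ∘ t := Function.update_eq_self j (g ∘ t)
        rw [this, smul_eq_mul]
      · intro i _ hij
        rw [AlternatingMap.map_update_smul, hc]
        have : b.det (Function.update (g ∘ t) j (g (t i))) = 0 :=
          AlternatingMap.map_update_self (b.det) (g ∘ t) hij.symm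
        rw [this]; simp
      · simp
    have h2 : Function.update (g ∘ t) j (g v) = g ∘ (Function.update t j v) := by
      rw [Function.comp_update]
    have h3 := ht (Function.update t j v)

    rw [← h2, h1, abs_mul] at h3
    have := abs_pos.mpr hpos
    exact le_of_mul_le_mul_right (by linarith) this
  obtain ⟨s0, hs0⟩ := hne
  refine ⟨fun j => if h : j.1 < r then t ⟨j, h⟩ else s0, ?_, ?_⟩
  · intro j; dsimp only; split_ifs
    · exact (t _).2
    · exact hs0
  · intro v hv
    refine ⟨fun j => if h : j.1 < r then c.repr (g ⟨v, hv⟩) ⟨j, h⟩ else 0, ?_, ?_⟩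
    · intro j; dsimp only; split_ifs
      · exact key _ _
      · simp
    · have h1 := congrArg (Subtype.val) (c.sum_repr (g ⟨v, hv⟩))
      simp only [hc] at h1
      have h2 : f v = ∑ i : Fin r, c.repr (g ⟨v, hv⟩) i • f (t i) := by
        rw [← show (g ⟨v, hv⟩ : W) = f v from rfl, ← h1]
        simp [g]
      obtain ⟨q, rfl⟩ := Nat.exists_eq_add_of_le hrN
      rw [Fin.sum_univ_add, h2]
      simp

lemma sdp_normalize {N K : ℕ} (hN : 0 < N) (X : Fin N → Matrix (Fin K) (Fin K) ℝ)
    (hX : ∀ j, (X j).PosSemidef) :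
    ∃ Y : Fin N → Matrix (Fin K) (Fin K) ℝ, (∀ j, (Y j).PosSemidef) ∧ ∑ j, Y j = 1 ∧
      ∀ l : Fin N → ℝ, ∑ j, l j = 1 →
        ((∑ j, l j • X j).PosSemidef ↔ (∑ j, l j • Y j).PosSemidef) := by
  classical
  have hC : (∑ j, X j).PosSemidef := posSemidef_sum _ fun j _ => hX j
  set D := hC.1.eigenvalues with hD
  set U : Matrix (Fin K) (Fin K) ℝ := (hC.1.eigenvectorUnitary : Matrix (Fin K) (Fin K) ℝ) with hU
  have hUU : Uᴴ * U = 1 := Unitary.coe_star_mul_self hC.1.eigenvectorUnitary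
  have hUC : Uᴴ * (∑ j, X j) * U = diagonal D := by
    have := hC.1.conjStarAlgAut_star_eigenvectorUnitary
    rw [Unitary.conjStarAlgAut_star_apply] at this
    exact this
  have hD0 : ∀ a, 0 ≤ D a := hC.eigenvalues_nonneg
  let s : Fin K → ℝ := fun a => if D a = 0 then 1 else (Real.sqrt (D a))⁻¹
  have hs : ∀ a, s a ≠ 0 := by
    intro a; simp only [s]; split_ifs with h
    · simp
    · exact inv_ne_zero (Real.sqrt_ne_zero'.mpr (lt_of_le_of_ne (hD0 a) (Ne.symm h)))
  let S := diagonal s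
  let S' := diagonal (fun a => (s a)⁻¹)
  let G := S * Uᴴ
  let G' := U * S'
  have hUU' : U * Uᴴ = 1 := mul_eq_one_comm.mp hUU
  have hSS : S' * S = 1 := by
    simp only [S, S', diagonal_mul_diagonal]
    rw [← diagonal_one]; congr 1; ext a; simp [hs a]
  have hG : G' * G = 1 := by
    simp only [G, G']
    calc U * S' * (S * Uᴴ) = U * (S' * S) * Uᴴ := by simp only [Matrix.mul_assoc]
      _ = 1 := by rw [hSS, Matrix.mul_one, hUU']
  let Q : Matrix (Fin K) (Fin K) ℝ := diagonal (fun a => if D a = 0 then 1 else 0)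
  let E : Matrix (Fin K) (Fin K) ℝ := diagonal (fun a => if D a = 0 then 0 else 1)
  have hQ : Q.PosSemidef := PosSemidef.diagonal (fun a => by simp only; split_ifs <;> simp)
  let W : Fin N → Matrix (Fin K) (Fin K) ℝ := fun j => G * X j * Gᴴ
  have hW : ∀ j, (W j).PosSemidef := fun j => (hX j).mul_mul_conjTranspose_same G
  have hWs : ∑ j, W j + Q = 1 := by
    have h1 : ∑ j, W j = S * diagonal D * S := by
      have hSt : Sᴴ = S := by simp [S, diagonal_conjTranspose]
      simp only [W, ← Finset.sum_mul, ← Finset.mul_sum, G, conjTranspose_mul, conjTranspose_conjTranspose, hSt]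
      rw [← hUC]; simp only [Matrix.mul_assoc]
    rw [h1]
    simp only [S, Q, diagonal_mul_diagonal, diagonal_add]
    rw [← diagonal_one]; congr 1; ext a
    simp only [s]; split_ifs with h
    · simp [h]
    · have h2 : 0 < D a := lt_of_le_of_ne (hD0 a) (Ne.symm h)
      have h3 := Real.mul_self_sqrt h2.le
      have h4 := (Real.sqrt_pos.mpr h2).ne'
      field_simp
      rw [pow_two]; linarith
  have hWd : ∀ a, D a = 0 → ∀ j, W j a a = 0 := by
    intro a ha j
    have h1 := congrFun (congrFun hWs a) a
    simp only [Matrix.add_apply, Matrix.sum_apply, Q, diagonal_apply_eq, ha, if_true, one_apply_eq] at h1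
    have h2 : ∑ j, W j a a = 0 := by linarith
    exact (Finset.sum_eq_zero_iff_of_nonneg (fun j _ => (hW j).diag_nonneg)).mp h2 j (Finset.mem_univ _)
  have hWz : ∀ a b, (D a = 0 ∨ D b = 0) → ∀ j, W j a b = 0 := by
    intro a b hab j
    have h1 := psd_entry_sq (hW j) a b
    have h2 : W j a a * W j b b = 0 := by
      rcases hab with h | h
      · rw [hWd a h]; simp
      · rw [hWd b h]; simp
    rw [h2] at h1
    exact pow_eq_zero_iff (two_ne_zero) |>.mp (le_antisymm h1 (sq_nonneg _))
  have hN' : (N : ℝ) ≠ 0 := by positivity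
  refine ⟨fun j => W j + (N : ℝ)⁻¹ • Q, fun j => (hW j).add (hQ.smul (by positivity)), ?_, ?_⟩
  · rw [Finset.sum_add_distrib]
    simp only [Finset.sum_const, Finset.card_univ, Fintype.card_fin]
    rw [← hWs, ← Nat.cast_smul_eq_nsmul ℝ, smul_smul, mul_inv_cancel₀ hN', one_smul]
  · intro l hl
    have e1 : ∑ j, l j • (W j + (N : ℝ)⁻¹ • Q) = ∑ j, l j • W j + (N : ℝ)⁻¹ • Q := by
      simp only [smul_add, Finset.sum_add_distrib, ← Finset.sum_smul, hl, one_smul]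
    have e2 : ∑ j, l j • W j = G * (∑ j, l j • X j) * Gᴴ := by
      simp only [W, Finset.mul_sum, Finset.sum_mul, Matrix.mul_smul, Matrix.smul_mul]
    rw [e1]
    constructor
    · intro h
      rw [e2]
      exact (h.mul_mul_conjTranspose_same G).add (hQ.smul (by positivity))
    · intro h
      have h1 := h.mul_mul_conjTranspose_same E
      have h2 : E * (∑ j, l j • W j + (N : ℝ)⁻¹ • Q) * Eᴴ = ∑ j, l j • W j := by
        ext a b
        simp only [E, diagonal_conjTranspose, Matrix.mul_diagonal, Matrix.diagonal_mul, Matrix.add_apply, Matrix.sum_apply, Matrix.smul_apply, Q,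
          Pi.star_apply, star_trivial]
        by_cases ha : D a = 0
        · simp [ha, hWz a b (Or.inl ha)]
        by_cases hb : D b = 0
        · simp [hb, hWz a b (Or.inr hb)]
        simp [ha, hb, diagonal_apply]
      rw [h2, e2] at h1
      have h3 := h1.mul_mul_conjTranspose_same G'
      have h4 : G' * (G * (∑ j, l j • X j) * Gᴴ) * G'ᴴ = ∑ j, l j • X j := by
        calc G' * (G * (∑ j, l j • X j) * Gᴴ) * G'ᴴ = (G' * G) * (∑ j, l j • X j) * (G' * G)ᴴ := by
              simp only [conjTranspose_mul, Matrix.mul_assoc]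
          _ = _ := by simp [hG]
      rwa [h4] at h3

end MatrixPart

lemma num_bound (d K : ℕ) (hd : 3 ≤ d) (hK : 1 ≤ K) (H : 81 * K ^ 4 * d ^ 2 ≤ 2 ^ d)
    (N D : ℕ) (hN : N = 1 + K ^ 2 + d) (hD : D = N ^ 2 * K * d) :
    1 + (2 ^ d) ^ N * (((2 * D + 1) ^ K) ^ K) ^ N ≤ 2 ^ (2 ^ (d - 1)) := by
  have hK2 : 1 ≤ K ^ 2 := Nat.one_le_pow _ _ hK
  have hN2 : N ≤ 2 * K ^ 2 * d := by
    rw [hN]; nlinarith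
  have hD1 : 2 * D + 1 ≤ 2 ^ (2 * d) := by
    have h1 : D ≤ 4 * K ^ 5 * d ^ 3 := by
      calc D = N ^ 2 * K * d := hD
        _ ≤ (2 * K ^ 2 * d) ^ 2 * K * d := by gcongr
        _ = _ := by ring
    have h2 : K ^ 5 * d ^ 3 ≤ K ^ 8 * d ^ 4 := by
      gcongr <;> omega
    have h3 : (81 * K ^ 4 * d ^ 2) ^ 2 ≤ 2 ^ (2 * d) := by
      rw [mul_comm 2 d, pow_mul]; gcongr
    have h4 : 1 ≤ K ^ 8 * d ^ 4 := Nat.mul_pos (by positivity) (by positivity)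
    nlinarith
  have h5 : (2 ^ d) ^ N * (((2 * D + 1) ^ K) ^ K) ^ N ≤ 2 ^ (6 * d ^ 2 * K ^ 4) := by
    calc (2 ^ d) ^ N * (((2 * D + 1) ^ K) ^ K) ^ N
        ≤ (2 ^ d) ^ N * (((2 ^ (2 * d)) ^ K) ^ K) ^ N := by gcongr
      _ = 2 ^ (d * N * (1 + 2 * K ^ 2)) := by
          rw [← pow_mul, ← pow_mul, ← pow_mul, ← pow_mul, ← pow_add]; congr 1; ring
      _ ≤ 2 ^ (6 * d ^ 2 * K ^ 4) := by
          apply Nat.pow_le_pow_right (by norm_num)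
          calc d * N * (1 + 2 * K ^ 2) ≤ d * (2 * K ^ 2 * d) * (3 * K ^ 2) := by
                gcongr; omega
            _ = _ := by ring
  have h6 : 6 * d ^ 2 * K ^ 4 + 1 ≤ 2 ^ (d - 1) := by
    obtain ⟨q, rfl⟩ : ∃ q, d = q + 1 := ⟨d - 1, by omega⟩
    have h7 : 1 ≤ (q + 1) ^ 2 * K ^ 4 := Nat.mul_pos (by positivity) (by positivity)
    rw [pow_succ 2 q] at H
    simp only [Nat.add_sub_cancel]
    nlinarith
  calc _ ≤ 2 ^ (6 * d ^ 2 * K ^ 4) + 2 ^ (6 * d ^ 2 * K ^ 4) := by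
        have := Nat.one_le_two_pow (n := 6 * d ^ 2 * K ^ 4)
        omega
    _ = 2 ^ (6 * d ^ 2 * K ^ 4 + 1) := by ring
    _ ≤ _ := Nat.pow_le_pow_right (by norm_num) h6

lemma num_zero (d : ℕ) (hd : 3 ≤ d) : 1 + 2 ^ d ≤ 2 ^ (2 ^ (d - 1)) := by
  have h : d + 1 ≤ 2 ^ (d - 1) := by
    induction d, hd using Nat.le_induction with
    | base => norm_num
    | succ n hn ih =>
      obtain ⟨q, rfl⟩ : ∃ q, n = q + 1 := ⟨n - 1, by omega⟩
      simp only [Nat.add_sub_cancel] at *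
      rw [pow_succ]; omega
  calc 1 + 2 ^ d ≤ 2 ^ (d + 1) := by have := Nat.one_le_two_pow (n := d); rw [pow_succ]; omega
    _ ≤ _ := Nat.pow_le_pow_right (by norm_num) h

lemma num_H (d K : ℕ) (hd : 3 ≤ d) (h : (K : ℝ) ≤ (2 : ℝ) ^ ((d : ℝ) / 4) / (3 * Real.sqrt d)) :
    81 * K ^ 4 * d ^ 2 ≤ 2 ^ d := by
  have hd0 : (0 : ℝ) < d := by positivity
  have hs : 0 < Real.sqrt d := Real.sqrt_pos.mpr hd0
  rw [le_div_iff₀ (by positivity)] at h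
  have h1 := pow_le_pow_left₀ (by positivity) h 4
  have h2 : ((2 : ℝ) ^ ((d : ℝ) / 4)) ^ 4 = 2 ^ d := by
    rw [← Real.rpow_natCast, ← Real.rpow_mul (by norm_num), ← Real.rpow_natCast]
    congr 1; push_cast; ring
  have h3 : Real.sqrt d ^ 4 = (d : ℝ) ^ 2 := by
    rw [show 4 = 2 * 2 from rfl, pow_mul, Real.sq_sqrt hd0.le]
  rw [h2, mul_pow, mul_pow, h3] at h1
  have : (81 * K ^ 4 * d ^ 2 : ℝ) ≤ 2 ^ d := by linarith
  exact_mod_cast this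

lemma num_target (d : ℕ) (hd : 3 ≤ d) : (2 : ℝ) ^ ((2 : ℝ) ^ (d : ℝ)) * (2 : ℝ) ^ (-((2 : ℝ) ^ ((d : ℝ) - 1)))
    = ((2 ^ (2 ^ (d - 1)) : ℕ) : ℝ) := by
  rw [← Real.rpow_add (by norm_num)]
  obtain ⟨q, rfl⟩ : ∃ q, d = q + 1 := ⟨d - 1, by omega⟩
  push_cast
  rw [← Real.rpow_natCast 2 (2 ^ _)]
  congr 1
  simp only [add_sub_cancel_right, Nat.add_sub_cancel]
  rw [Real.rpow_add (by norm_num), Real.rpow_natCast]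
  push_cast
  simp; ring

section Geometry

open scoped Matrix

lemma affine_comb {n : ℕ} {W : Type*} [AddCommGroup W] [Module ℝ W] (f : EuclideanSpace ℝ (Fin n) →ᵃ[ℝ] W)
    {N : ℕ} (l : Fin N → ℝ) (x : Fin N → EuclideanSpace ℝ (Fin n)) (hl : ∑ j, l j = 1) :
    f (∑ j, l j • x j) = ∑ j, l j • f (x j) := by
  have h : ∀ y, f y = f.linear y + f 0 := fun y => congrFun (AffineMap.decomp f) y
  rw [h, map_sum]
  have : ∑ j, l j • f (x j) = ∑ j, l j • (f.linear (x j) + f 0) :=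
    Finset.sum_congr rfl fun j _ => by rw [← h]
  rw [this]
  simp only [map_smul, smul_add, Finset.sum_add_distrib, ← Finset.sum_smul, hl, one_smul]

lemma hasSdpExt_of_hasLinExt {d l : ℕ} {P : Set (EuclideanSpace ℝ (Fin d))} (h : HasLinExt P l) :
    HasSdpExt P l := by
  obtain ⟨n, φ, a, rfl⟩ := h
  refine ⟨n, φ, (Matrix.diagonalLinearMap (Fin l) ℝ ℝ).toAffineMap.comp (AffineMap.pi a), ?_, ?_⟩
  · intro x; simp [Matrix.IsSymm]
  · congr 1; ext x
    simp [Matrix.posSemidef_diagonal_iff]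

lemma hasLinExt_convexHull {d : ℕ} (s : Finset (EuclideanSpace ℝ (Fin d))) :
    ∃ l, HasLinExt (convexHull ℝ (s : Set (EuclideanSpace ℝ (Fin d)))) l := by
  classical
  let n := s.card
  let p : Fin n → EuclideanSpace ℝ (Fin d) := fun i => (s.equivFin.symm i : EuclideanSpace ℝ (Fin d))
  let co : Fin n → (EuclideanSpace ℝ (Fin n) →ₗ[ℝ] ℝ) := fun i => (EuclideanSpace.proj i : EuclideanSpace ℝ (Fin n) →L[ℝ] ℝ)
  have hco : ∀ i x, co i x = x i := fun i x => rfl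
  let S : EuclideanSpace ℝ (Fin n) →ᵃ[ℝ] ℝ := (∑ i, co i).toAffineMap
  have hS : ∀ x, S x = ∑ i, x i := fun x => by simp [S, hco]
  let F : EuclideanSpace ℝ (Fin n) →ₗ[ℝ] EuclideanSpace ℝ (Fin d) := ∑ i, (co i).smulRight (p i)
  have hF : ∀ x, F x = ∑ i, x i • p i := fun x => by simp [F, hco]
  refine ⟨n + 1 + 1, n, F.toAffineMap,
    Fin.cons (S - AffineMap.const ℝ _ 1) (Fin.cons (AffineMap.const ℝ _ 1 - S) (fun i => (co i).toAffineMap)), ?_⟩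
  have hset : {x : EuclideanSpace ℝ (Fin n) | ∀ i, 0 ≤ (Fin.cons (S - AffineMap.const ℝ _ 1) (Fin.cons (AffineMap.const ℝ _ 1 - S) (fun i => (co i).toAffineMap)) : Fin (n + 1 + 1) → (EuclideanSpace ℝ (Fin n) →ᵃ[ℝ] ℝ)) i x}
      = {x | (∀ i, 0 ≤ x i) ∧ ∑ i, x i = 1} := by
    ext x
    simp only [Set.mem_ofPred_eq, Fin.forall_fin_succ, Fin.cons_zero, Fin.cons_succ, AffineMap.coe_sub, Pi.sub_apply, hS, AffineMap.const_apply, LinearMap.coe_toAffineMap, hco]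
    constructor
    · rintro ⟨h1, h2, h3⟩; exact ⟨h3, by linarith⟩
    · rintro ⟨h1, h2⟩; exact ⟨by linarith, by linarith, h1⟩
  rw [hset]
  ext y
  rw [Finset.mem_convexHull']
  have hsum : ∀ {W : Type} [AddCommMonoid W] (g : EuclideanSpace ℝ (Fin d) → W),
      ∑ y ∈ s, g y = ∑ i, g (p i) := by
    intro W _ g
    rw [← Finset.sum_coe_sort s g]
    exact (Equiv.sum_comp s.equivFin.symm (fun y : s => g y)).symm
  constructor
  · rintro ⟨w, h0, h1, h2⟩
    refine ⟨WithLp.toLp 2 (fun i => w (p i)), ⟨fun i => h0 _ (s.equivFin.symm i).2, ?_⟩, ?_⟩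
    · rw [hsum] at h1; exact h1
    · rw [hsum] at h2; rw [LinearMap.coe_toAffineMap, hF]; exact h2
  · rintro ⟨x, ⟨h0, h1⟩, h2⟩
    have hx : ∀ i, (fun y => if h : y ∈ s then x (s.equivFin ⟨y, h⟩) else 0) (p i) = x i := by
      intro i
      have : p i ∈ s := (s.equivFin.symm i).2
      simp only [this, dif_pos]
      have h3 : s.equivFin ⟨p i, this⟩ = i := by simp [p]
      rw [h3]
    refine ⟨fun y => if h : y ∈ s then x (s.equivFin ⟨y, h⟩) else 0, ?_, ?_, ?_⟩
    · intro y hy; simp only [hy, dif_pos]; exact h0 _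
    · rw [hsum]; simp only [hx]; exact h1
    · rw [hsum]; simp only [hx]; rw [← h2, LinearMap.coe_toAffineMap, hF]

lemma hasSdpExt_point {d : ℕ} (p : EuclideanSpace ℝ (Fin d)) : HasSdpExt {p} 0 := by
  refine ⟨0, AffineMap.const ℝ _ p, AffineMap.const ℝ _ 0, by simp, ?_⟩
  ext y
  simp only [Set.mem_singleton_iff, Set.mem_image, Set.mem_ofPred_eq, AffineMap.const_apply]
  constructor
  · rintro rfl; exact ⟨0, Matrix.PosSemidef.zero, rfl⟩
  · rintro ⟨_, _, rfl⟩; rfl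

lemma hasSdpExt_sxc {d : ℕ} {V : Set (EuclideanSpace ℝ (Fin d))} (hV : V.Finite) (hne : V.Nonempty) :
    HasSdpExt (convexHull ℝ V) (sxc (convexHull ℝ V)) := by
  unfold sxc
  split_ifs with h
  · rcases h with h | ⟨p, h⟩
    · simp [hne.ne_empty] at h
    · rw [h]; exact hasSdpExt_point p
  · apply Nat.sInf_mem (s := {k | HasSdpExt (convexHull ℝ V) k})
    obtain ⟨l, hl⟩ := hasLinExt_convexHull hV.toFinset
    rw [hV.coe_toFinset] at hl
    exact ⟨l, hasSdpExt_of_hasLinExt hl⟩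

lemma cube_finite (d : ℕ) : {x : EuclideanSpace ℝ (Fin d) | ∀ i, x i = 0 ∨ x i = 1}.Finite := by
  have : {x : EuclideanSpace ℝ (Fin d) | ∀ i, x i = 0 ∨ x i = 1} ⊆
      Set.range (fun b : Fin d → Bool => (WithLp.toLp 2 (fun i => if b i then (1 : ℝ) else 0) : EuclideanSpace ℝ (Fin d))) := by
    intro x hx
    refine ⟨fun i => decide (x i = 1), ?_⟩
    ext i
    rcases hx i with h | h <;> simp [h]
  exact (Set.finite_range _).subset this

lemma cube_card (d : ℕ) : Nat.card {x : EuclideanSpace ℝ (Fin d) | ∀ i, x i = 0 ∨ x i = 1} ≤ 2 ^ d := by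
  have : {x : EuclideanSpace ℝ (Fin d) | ∀ i, x i = 0 ∨ x i = 1} ⊆
      Set.range (fun b : Fin d → Bool => (WithLp.toLp 2 (fun i => if b i then (1 : ℝ) else 0) : EuclideanSpace ℝ (Fin d))) := by
    intro x hx
    refine ⟨fun i => decide (x i = 1), ?_⟩
    ext i
    rcases hx i with h | h <;> simp [h]
  refine (Nat.card_mono (Set.finite_range _) this).trans ?_
  refine (Finite.card_range_le _).trans ?_
  simp

/-- size zero: only points -/
lemma subsingleton_of_zero {d : ℕ} {V : Set (EuclideanSpace ℝ (Fin d))}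
    (hV : V ⊆ {x | ∀ i, x i = 0 ∨ x i = 1}) (h : HasSdpExt (convexHull ℝ V) 0) : V.Subsingleton := by
  obtain ⟨n, φ, M, -, hP⟩ := h
  have hM : ∀ x, (M x).PosSemidef := fun x => by
    have : M x = 0 := Subsingleton.elim _ _
    rw [this]; exact Matrix.PosSemidef.zero
  intro v hv w hw
  have hcube : ∀ y ∈ convexHull ℝ V, ∀ i, 0 ≤ y i ∧ y i ≤ 1 := by
    intro y hy
    have : convexHull ℝ V ⊆ {y | ∀ i, 0 ≤ y i ∧ y i ≤ 1} := by
      apply convexHull_min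
      · intro x hx i
        rcases hV hx i with h | h <;> simp [h]
      · intro x hx y hy a b ha hb hab i
        have := hx i; have := hy i
        simp only [PiLp.add_apply, PiLp.smul_apply, smul_eq_mul]
        constructor <;> nlinarith
    exact this hy
  have hv' := subset_convexHull ℝ V hv
  have hw' := subset_convexHull ℝ V hw
  rw [hP] at hv' hw'
  obtain ⟨x, -, hx⟩ := hv'
  obtain ⟨y, -, hy⟩ := hw'
  have h1 : φ (∑ j, (![-1, 2] : Fin 2 → ℝ) j • ![x, y] j) ∈ convexHull ℝ V := by
    rw [hP]; exact ⟨_, hM _, rfl⟩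
  have h2 : φ (∑ j, (![2, -1] : Fin 2 → ℝ) j • ![x, y] j) ∈ convexHull ℝ V := by
    rw [hP]; exact ⟨_, hM _, rfl⟩
  rw [affine_comb φ _ _ (by simp; norm_num)] at h1 h2
  ext i
  replace h1 := hcube _ h1 i
  replace h2 := hcube _ h2 i
  simp [hx, hy] at h1 h2
  rcases hV hv i with h | h <;> rcases hV hw i with h' | h' <;> rw [h, h'] <;> (exfalso; linarith [h1.1, h1.2, h2.1, h2.2])

lemma lift_exists {d k K : ℕ} (hk : k ≤ K) {V : Set (EuclideanSpace ℝ (Fin d))}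
    (h : HasSdpExt (convexHull ℝ V) k) :
    ∃ X : EuclideanSpace ℝ (Fin d) → Matrix (Fin K) (Fin K) ℝ, (∀ v ∈ V, (X v).PosSemidef) ∧
      ∀ (N : ℕ) (e : Fin N → EuclideanSpace ℝ (Fin d)) (l : Fin N → ℝ), (∀ j, e j ∈ V) → ∑ j, l j = 1 →
        (∑ j, l j • X (e j)).PosSemidef → ∑ j, l j • e j ∈ convexHull ℝ V := by
  classical
  obtain ⟨n, φ, M, -, hP⟩ := h
  have hx : ∀ v : EuclideanSpace ℝ (Fin d), ∃ x, v ∈ V → (M x).PosSemidef ∧ φ x = v := by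
    intro v
    by_cases hv : v ∈ V
    · have := subset_convexHull ℝ V hv
      rw [hP] at this
      obtain ⟨x, h1, h2⟩ := this
      exact ⟨x, fun _ => ⟨h1, h2⟩⟩
    · exact ⟨0, fun h => absurd h hv⟩
  choose x hx using hx
  let J : Matrix (Fin K) (Fin k) ℝ := (1 : Matrix (Fin K) (Fin K) ℝ).submatrix id (Fin.castLE hk)
  have hJ : Jᴴ * J = 1 := by
    ext a b
    simp only [J, Matrix.mul_apply, Matrix.conjTranspose_apply, Matrix.submatrix_apply, id, star_trivial, Matrix.one_apply]
    rw [Finset.sum_eq_single (Fin.castLE hk a)]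
    · simp
    · intro c _ hc
      simp [hc]
    · simp
  refine ⟨fun v => J * M (x v) * Jᴴ, fun v hv => (hx v hv).1.mul_mul_conjTranspose_same J, ?_⟩
  intro N e l he hl hpsd
  have h1 : ∑ j, l j • (J * M (x (e j)) * Jᴴ) = J * M (∑ j, l j • x (e j)) * Jᴴ := by
    rw [affine_comb M _ _ hl]
    simp only [Matrix.mul_sum, Matrix.sum_mul, Matrix.mul_smul, Matrix.smul_mul]
  rw [h1] at hpsd
  have h2 := hpsd.conjTranspose_mul_mul_same J
  have h3 : Jᴴ * (J * M (∑ j, l j • x (e j)) * Jᴴ) * J = M (∑ j, l j • x (e j)) := by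
    calc _ = (Jᴴ * J) * M (∑ j, l j • x (e j)) * (Jᴴ * J) := by simp only [Matrix.mul_assoc]
      _ = _ := by rw [hJ]; simp
  rw [h3] at h2
  rw [hP]
  refine ⟨_, h2, ?_⟩
  rw [affine_comb φ _ _ hl]
  exact Finset.sum_congr rfl fun j _ => by rw [(hx _ (he j)).2]

/-- Normalized compact description of `V` by data `e`, `Y`. -/
def SdpData {d N K : ℕ} (V : Set (EuclideanSpace ℝ (Fin d))) (e : Fin N → EuclideanSpace ℝ (Fin d))
    (Y : Fin N → Matrix (Fin K) (Fin K) ℝ) : Prop :=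
  (∀ j, e j ∈ V) ∧ (∀ j, (Y j).PosSemidef) ∧ ∑ j, Y j = 1 ∧
  (∀ w ∈ V, ∃ l : Fin N → ℝ, (∀ j, |l j| ≤ 1) ∧ ∑ j, l j = 1 ∧ ∑ j, l j • e j = w ∧
    (∑ j, l j • Y j).PosSemidef) ∧
  (∀ l : Fin N → ℝ, ∑ j, l j = 1 → (∑ j, l j • Y j).PosSemidef → ∑ j, l j • e j ∈ convexHull ℝ V)

lemma sdpData_exists {d k K N : ℕ} (hk : k ≤ K) (hN : N = 1 + K ^ 2 + d) {V : Set (EuclideanSpace ℝ (Fin d))}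
    (hfin : V.Finite) (hne : V.Nonempty) (h : HasSdpExt (convexHull ℝ V) k) :
    ∃ (e : Fin N → EuclideanSpace ℝ (Fin d)) (Y : Fin N → Matrix (Fin K) (Fin K) ℝ), SdpData V e Y := by
  obtain ⟨X, hX, hX2⟩ := lift_exists hk h
  obtain ⟨e, he, hsp⟩ := spanner (fun v => ((1 : ℝ), X v, v)) V hfin hne N (by
    rw [Module.finrank_prod, Module.finrank_prod, Module.finrank_matrix]
    simp [hN]; nlinarith)
  obtain ⟨Y, hY, hY1, hYl⟩ := sdp_normalize (by omega) (fun j => X (e j)) (fun j => hX _ (he j))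
  refine ⟨e, Y, he, hY, hY1, ?_, ?_⟩
  · intro w hw
    obtain ⟨l, hl, hs⟩ := hsp w hw
    simp only [Prod.smul_mk, Prod.ext_iff, Prod.fst_sum, Prod.snd_sum, smul_eq_mul, mul_one] at hs
    obtain ⟨h1, h2, h3⟩ := hs
    refine ⟨l, hl, h1.symm, h3.symm, ?_⟩
    rw [← hYl l h1.symm, ← h2]
    exact hX w hw
  · intro l hl hp
    exact hX2 N e l he hl ((hYl l hl).mpr hp)

lemma sdpData_entry {d N K : ℕ} {V : Set (EuclideanSpace ℝ (Fin d))} {e : Fin N → EuclideanSpace ℝ (Fin d)}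
    {Y : Fin N → Matrix (Fin K) (Fin K) ℝ} (h : SdpData V e Y) (j : Fin N) (a b : Fin K) : |Y j a b| ≤ 1 := by
  obtain ⟨-, h1, h2, -⟩ := h
  have hd : ∀ a, 0 ≤ Y j a a ∧ Y j a a ≤ 1 := by
    intro a
    refine ⟨(h1 j).diag_nonneg, ?_⟩
    have := congrFun (congrFun h2 a) a
    rw [Matrix.sum_apply, Matrix.one_apply_eq] at this
    rw [← this]
    exact Finset.single_le_sum (f := fun j => Y j a a) (fun i _ => (h1 i).diag_nonneg) (Finset.mem_univ j)
  have h3 := psd_entry_sq (h1 j) a b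
  have := hd a
  have := hd b
  rw [abs_le_one_iff_mul_self_le_one]
  nlinarith

lemma sdpData_sub {d N K D : ℕ} (hd : 0 < d) (hK : 0 < K) (hN : 0 < N) (hD : D = N ^ 2 * K * d)
    {V V' : Set (EuclideanSpace ℝ (Fin d))}
    (hV : V ⊆ {x | ∀ i, x i = 0 ∨ x i = 1}) (hV' : V' ⊆ {x | ∀ i, x i = 0 ∨ x i = 1})
    {e : Fin N → EuclideanSpace ℝ (Fin d)}
    {Y Y' : Fin N → Matrix (Fin K) (Fin K) ℝ} (h : SdpData V e Y) (h' : SdpData V' e Y')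
    (hc : ∀ j a b, ⌊Y j a b * D⌋ = ⌊Y' j a b * D⌋) : V ⊆ V' := by
  intro w hw
  by_contra hw'
  obtain ⟨-, hY, hY1, hrep, -⟩ := h
  obtain ⟨he', hY', hY1', -, hmem⟩ := h'
  obtain ⟨l, hl, hl1, hlw, hlp⟩ := hrep w hw
  have hD0 : (0 : ℝ) < D := by
    rw [hD]; positivity
  have hN0 : (0 : ℝ) < N := by positivity
  have hd0 : (0 : ℝ) < d := by positivity
  set θ : ℝ := 1 / (N * d) with hθ
  have hθ0 : 0 < θ := by positivity
  -- closeness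
  have hclose : ∀ j a b, |Y' j a b - Y j a b| ≤ 1 / D := by
    intro j a b
    have h1 := Int.abs_sub_lt_one_of_floor_eq_floor (hc j a b)
    rw [← sub_mul, abs_mul, abs_of_pos hD0] at h1
    rw [le_div_iff₀ hD0, abs_sub_comm]
    exact h1.le
  have hZ : (∑ j, l j • (Y' j - Y j) + ((K : ℝ) * (N * (1 / D))) • (1 : Matrix (Fin K) (Fin K) ℝ)).PosSemidef := by
    apply psd_pert
    · unfold Matrix.IsHermitian
      rw [Matrix.conjTranspose_sum]
      refine Finset.sum_congr rfl fun j _ => ?_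
      rw [Matrix.conjTranspose_smul, Matrix.conjTranspose_sub, (hY' j).1.eq, (hY j).1.eq]
      simp
    · intro a b
      rw [Matrix.sum_apply]
      refine (Finset.abs_sum_le_sum_abs _ _).trans ?_
      have : ∑ j : Fin N, |(l j • (Y' j - Y j)) a b| ≤ ∑ j : Fin N, (1 / D : ℝ) := by
        refine Finset.sum_le_sum fun j _ => ?_
        rw [Matrix.smul_apply, Matrix.sub_apply, smul_eq_mul, abs_mul]
        calc _ ≤ 1 * |Y' j a b - Y j a b| := mul_le_mul_of_nonneg_right (hl j) (abs_nonneg _)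
          _ ≤ _ := by rw [one_mul]; exact hclose j a b
      simpa using this
  have hθ' : (K : ℝ) * (N * (1 / D)) = θ := by
    rw [hθ, hD]; push_cast; field_simp
  rw [hθ'] at hZ
  have hpsd := hlp.add hZ
  have hpsd2 : (∑ j, (l j + θ) • Y' j).PosSemidef := by
    have : ∑ j, (l j + θ) • Y' j = ∑ j, l j • Y j + (∑ j, l j • (Y' j - Y j) + θ • (1 : Matrix (Fin K) (Fin K) ℝ)) := by
      rw [← hY1']
      simp only [add_smul, smul_sub, Finset.sum_add_distrib, Finset.sum_sub_distrib, Finset.smul_sum]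
      abel
    rw [this]; exact hpsd
  have hT : 0 < 1 + N * θ := by positivity
  have hmem' := hmem (fun j => (1 + N * θ)⁻¹ * (l j + θ))
    (by
      rw [← Finset.mul_sum, Finset.sum_add_distrib, hl1]
      simp
      field_simp)
    (by
      simp only [mul_smul, ← Finset.smul_sum]
      exact hpsd2.smul (by positivity))
  -- separating functional
  let q : EuclideanSpace ℝ (Fin d) → ℝ := fun x => ∑ i, (1 - 2 * w i) * x i
  let c : ℝ := ∑ i, w i
  have hsep : ∀ x : EuclideanSpace ℝ (Fin d), (∀ i, x i = 0 ∨ x i = 1) → x ≠ w → 1 ≤ c + q x := by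
    intro x hx hxw
    simp only [c, q, ← Finset.sum_add_distrib]
    obtain ⟨i, hi⟩ : ∃ i, x i ≠ w i := by
      by_contra! hall
      exact hxw (by ext i; exact hall i)
    have hnn : ∀ i ∈ Finset.univ, 0 ≤ w i + (1 - 2 * w i) * x i := by
      intro i _
      rcases hx i with h | h <;> rcases hV hw i with h' | h' <;> rw [h, h'] <;> norm_num
    refine le_trans ?_ (Finset.single_le_sum hnn (Finset.mem_univ i))
    rcases hx i with h | h <;> rcases hV hw i with h' | h' <;> rw [h, h'] at hi ⊢ <;> first | exact absurd rfl hi | norm_num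
  have hup : ∀ x : EuclideanSpace ℝ (Fin d), (∀ i, x i = 0 ∨ x i = 1) → c + q x ≤ d := by
    intro x hx
    simp only [c, q, ← Finset.sum_add_distrib]
    have : ∑ i, (w i + (1 - 2 * w i) * x i) ≤ ∑ i : Fin d, (1 : ℝ) := by
      refine Finset.sum_le_sum fun i _ => ?_
      rcases hx i with h | h <;> rcases hV hw i with h' | h' <;> rw [h, h'] <;> norm_num
    simpa using this
  have hqw : c + q w = 0 := by
    simp only [c, q, ← Finset.sum_add_distrib]
    refine Finset.sum_eq_zero fun i _ => ?_
    rcases hV hw i with h' | h' <;> rw [h'] <;> norm_num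
  have hqlin : ∀ m : Fin N → ℝ, q (∑ j, m j • e j) = ∑ j, m j * q (e j) := by
    intro m
    simp only [q, WithLp.ofLp_sum, Finset.sum_apply, WithLp.ofLp_smul, Pi.smul_apply, smul_eq_mul, Finset.mul_sum]
    rw [Finset.sum_comm]
    refine Finset.sum_congr rfl fun j _ => Finset.sum_congr rfl fun i _ => by ring
  have hge : 1 ≤ c + q (∑ j, ((1 + N * θ)⁻¹ * (l j + θ)) • e j) := by
    have : convexHull ℝ V' ⊆ {x | 1 ≤ c + q x} := by
      apply convexHull_min
      · intro x hx
        exact hsep x (hV' hx) (fun hh => hw' (hh ▸ hx))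
      · intro x hx y hy a b ha hb hab
        have : q (a • x + b • y) = a * q x + b * q y := by
          simp only [q, PiLp.add_apply, PiLp.smul_apply, smul_eq_mul, Finset.mul_sum, ← Finset.sum_add_distrib]
          exact Finset.sum_congr rfl fun i _ => by ring
        simp only [Set.mem_ofPred_eq] at *
        rw [this]
        have hcc : c = a * c + b * c := by rw [← add_mul, hab, one_mul]
        nlinarith
    exact this hmem'
  rw [hqlin] at hge
  have e1 : ∑ j, (1 + N * θ)⁻¹ * (l j + θ) * q (e j) = (1 + N * θ)⁻¹ * (q w + θ * ∑ j, q (e j)) := by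
    rw [← hlw, hqlin]
    rw [Finset.mul_sum, ← Finset.sum_add_distrib, Finset.mul_sum]
    exact Finset.sum_congr rfl fun j _ => by ring
  have e2 : ∑ j, q (e j) ≤ N * (d - c) := by
    have : ∑ j, q (e j) ≤ ∑ j : Fin N, (d - c) := by
      refine Finset.sum_le_sum fun j _ => ?_
      have := hup (e j) (hV' (he' j))
      linarith
    simpa [mul_sub] using this
  rw [e1] at hge
  have e3 : (1 + N * θ) ≤ (1 + N * θ) * c + (q w + θ * ∑ j, q (e j)) := by
    have := mul_le_mul_of_nonneg_left hge hT.le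
    rw [mul_add, ← mul_assoc, mul_inv_cancel₀ hT.ne', one_mul, mul_one] at this
    exact this
  have e4 : θ * ∑ j, q (e j) ≤ θ * (N * (d - c)) := mul_le_mul_of_nonneg_left e2 hθ0.le
  have e5 : θ * (N * d) = 1 := by rw [hθ]; field_simp
  have e6 : 0 < N * θ := by positivity
  nlinarith

lemma count_pos {d K N D : ℕ} (hd : 0 < d) (hK : 0 < K) (hN : N = 1 + K ^ 2 + d) (hD : D = N ^ 2 * K * d) :
    Nat.card {V : Set (EuclideanSpace ℝ (Fin d)) | V ⊆ {x | ∀ i, x i = 0 ∨ x i = 1} ∧ V.Nonempty ∧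
      ∃ k ≤ K, HasSdpExt (convexHull ℝ V) k} ≤ (2 ^ d) ^ N * (((2 * D + 1) ^ K) ^ K) ^ N := by
  classical
  set Q : Set (EuclideanSpace ℝ (Fin d)) := {x | ∀ i, x i = 0 ∨ x i = 1} with hQ
  set T := {V : Set (EuclideanSpace ℝ (Fin d)) | V ⊆ Q ∧ V.Nonempty ∧
      ∃ k ≤ K, HasSdpExt (convexHull ℝ V) k} with hT
  have hex : ∀ V : T, ∃ (e : Fin N → EuclideanSpace ℝ (Fin d)) (Y : Fin N → Matrix (Fin K) (Fin K) ℝ), SdpData V.1 e Y := by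
    rintro ⟨V, hV, hne, k, hk, h⟩
    exact sdpData_exists hk hN ((cube_finite d).subset hV) hne h
  choose e Y hdata using hex
  have hfin : Finite Q := cube_finite d
  let F : T → (Fin N → Q) × (Fin N → Fin K → Fin K → Finset.Icc (-(D : ℤ)) D) := fun V =>
    (fun j => ⟨e V j, V.2.1 ((hdata V).1 j)⟩, fun j a b => ⟨⌊Y V j a b * D⌋, by
      have h1 := abs_le.mp (sdpData_entry (hdata V) j a b)
      have hD0 : (0 : ℝ) ≤ D := by positivity
      rw [Finset.mem_Icc]
      constructor
      · rw [Int.le_floor]; push_cast; nlinarith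
      · have : (⌊Y V j a b * D⌋ : ℝ) ≤ D := (Int.floor_le _).trans (by nlinarith)
        exact_mod_cast this⟩)
  have hF : Function.Injective F := by
    intro V V' hVV
    have h1 : e V = e V' := by
      ext1 j
      exact congrArg Subtype.val (congrFun (congrArg Prod.fst hVV) j)
    have h2 : ∀ j a b, ⌊Y V j a b * D⌋ = ⌊Y V' j a b * D⌋ := by
      intro j a b
      exact congrArg Subtype.val (congrFun (congrFun (congrFun (congrArg Prod.snd hVV) j) a) b)
    have d1 := hdata V
    have d2 := hdata V'
    rw [← h1] at d2
    apply Subtype.ext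
    exact Set.Subset.antisymm (sdpData_sub hd hK (by omega) hD V.2.1 V'.2.1 d1 d2 h2)
      (sdpData_sub hd hK (by omega) hD V'.2.1 V.2.1 d2 d1 (fun j a b => (h2 j a b).symm))
  refine (Nat.card_le_card_of_injective F hF).trans ?_
  rw [Nat.card_prod, Nat.card_fun, Nat.card_fun, Nat.card_fun, Nat.card_fun]
  simp only [Nat.card_eq_fintype_card (α := Fin _), Fintype.card_fin]
  have hI : Nat.card (Finset.Icc (-(D : ℤ)) D) = 2 * D + 1 := by
    rw [Nat.card_eq_fintype_card, Fintype.card_coe, Int.card_Icc]; omega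
  rw [hI]
  gcongr
  exact cube_card d

end Geometry

theorem statement12 (d : ℕ) (hd : 3 ≤ d) :
    {V : Set (EuclideanSpace ℝ (Fin d)) | V ⊆ {x | ∀ i, x i = 0 ∨ x i = 1} ∧
        (sxc (convexHull ℝ V) : ℝ) ≤ (2 : ℝ) ^ ((d : ℝ) / 4) / (3 * Real.sqrt d)}.Finite ∧
    ({V : Set (EuclideanSpace ℝ (Fin d)) | V ⊆ {x | ∀ i, x i = 0 ∨ x i = 1} ∧
        (sxc (convexHull ℝ V) : ℝ) ≤ (2 : ℝ) ^ ((d : ℝ) / 4) / (3 * Real.sqrt d)}.ncard : ℝ)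
      ≤ (2 : ℝ) ^ ((2 : ℝ) ^ (d : ℝ)) * (2 : ℝ) ^ (-((2 : ℝ) ^ ((d : ℝ) - 1))) := by
  classical
  set Q : Set (EuclideanSpace ℝ (Fin d)) := {x | ∀ i, x i = 0 ∨ x i = 1} with hQ
  set T := {V : Set (EuclideanSpace ℝ (Fin d)) | V ⊆ Q ∧
        (sxc (convexHull ℝ V) : ℝ) ≤ (2 : ℝ) ^ ((d : ℝ) / 4) / (3 * Real.sqrt d)} with hT
  have hpow : {V : Set (EuclideanSpace ℝ (Fin d)) | V ⊆ Q}.Finite := (cube_finite d).finite_subsets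
  have hTfin : T.Finite := hpow.subset fun V hV => hV.1
  refine ⟨hTfin, ?_⟩
  rw [num_target d hd]
  set κ : ℝ := (2 : ℝ) ^ ((d : ℝ) / 4) / (3 * Real.sqrt d) with hκ
  have hκ0 : 0 ≤ κ := by positivity
  set K := ⌊κ⌋₊ with hK
  let T' := {V : Set (EuclideanSpace ℝ (Fin d)) | V ⊆ Q ∧ V.Nonempty ∧
      ∃ k ≤ K, HasSdpExt (convexHull ℝ V) k}
  have hT'fin : T'.Finite := hpow.subset fun V hV => hV.1
  have hsub : T ⊆ insert ∅ T' := by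
    rintro V ⟨hV, hs⟩
    rcases V.eq_empty_or_nonempty with h | h
    · exact Or.inl h
    · exact Or.inr ⟨hV, h, _, Nat.le_floor hs, hasSdpExt_sxc ((cube_finite d).subset hV) h⟩
  have h1 : T.ncard ≤ 1 + T'.ncard := by
    have := Set.ncard_le_ncard hsub (hT'fin.insert _)
    have := Set.ncard_insert_le (∅ : Set (EuclideanSpace ℝ (Fin d))) T'
    omega
  have h2 : 1 + T'.ncard ≤ 2 ^ (2 ^ (d - 1)) := by
    rcases Nat.eq_zero_or_pos K with h0 | hpos
    · refine le_trans ?_ (num_zero d hd)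
      have hs : T' ⊆ (fun x => {x}) '' Q := by
        rintro V ⟨hV, ⟨v, hv⟩, k, hk, h⟩
        obtain rfl : k = 0 := by omega
        have := subsingleton_of_zero hV h
        exact ⟨v, hV hv, (this.eq_singleton_of_mem hv).symm⟩
      have h3 := Set.ncard_le_ncard hs ((cube_finite d).image _)
      have h4 := Set.ncard_image_le (f := fun x : EuclideanSpace ℝ (Fin d) => ({x} : Set _)) (cube_finite d)
      have h5 := cube_card d
      rw [Nat.card_coe_set_eq] at h5
      have := (h3.trans h4).trans h5
      omega
    · have h3 := count_pos (d := d) (by omega) hpos rfl rfl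
      rw [Nat.card_coe_set_eq] at h3
      have h4 := num_bound d K hd hpos (num_H d K hd (Nat.floor_le hκ0)) _ _ rfl rfl
      exact (Nat.add_le_add_left h3 1).trans h4
  exact_mod_cast h1.trans h2
end
end

section
/- Let d ∈ ℕ with d ≥ 3. There exists a 0/1-polytope P in ℝ^d with sxc(P) > 2^{d/4}/(3·√d), and there exists a 0/1-polytope P' in ℝ^d with xc(P') > 2^{d/2}/(9·d). -/
open Metric Set

noncomputable section

section Helpers


lemma maxvol {α ι : Type*} [Fintype ι] (f : α → ι → ℝ) (V : Finset α) (hV : V.Nonempty) :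
    ∃ v : ι → α, (∀ i, v i ∈ V) ∧ ∀ w ∈ V, ∃ c : ι → ℝ, (∀ i, |c i| ≤ 1) ∧
      f w = ∑ i, c i • f (v i) := by
  classical
  set W : Submodule ℝ (ι → ℝ) := Submodule.span ℝ (f '' V) with hW
  let F : V → W := fun w => ⟨f w, Submodule.subset_span ⟨w, w.2, rfl⟩⟩
  have hF : (⊤ : Submodule ℝ W) ≤ Submodule.span ℝ (range F) := by
    have h2 : (Submodule.span ℝ (range F)).map W.subtype = W := by
      have h3 : W.subtype '' range F = f '' V := by
        ext x
        simp only [mem_image, mem_range, exists_exists_eq_and]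
        constructor
        · rintro ⟨a, rfl⟩
          exact ⟨a, a.2, rfl⟩
        · rintro ⟨a, ha, rfl⟩
          exact ⟨⟨a, ha⟩, rfl⟩
      rw [Submodule.map_span, h3]
    intro x _
    have hx : (x : ι → ℝ) ∈ (Submodule.span ℝ (range F)).map W.subtype := by rw [h2]; exact x.2
    obtain ⟨y, hy, hyx⟩ := hx
    have : y = x := Subtype.ext hyx
    exact this ▸ hy
  -- a basis inside
  obtain ⟨κ, b0, hb0⟩ : ∃ (κ : Set W) (b0 : Module.Basis κ ℝ W), ∀ i, ∃ w : V, F w = b0 i :=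
    ⟨_, Module.Basis.ofSpan hF,
      fun i => Module.Basis.ofSpan_subset hF (Set.mem_range_self i)⟩
  obtain ⟨v0, hv0⟩ := Classical.axiomOfChoice hb0
  have : Fintype κ :=
    Module.Basis.fintypeIndexOfRankLtAleph0 b0 (Module.rank_lt_aleph0 ℝ W)
  let g : (κ → V) → ℝ := fun v => |b0.det (fun i => F (v i))|
  have : Nonempty (κ → V) := ⟨v0⟩
  obtain ⟨v, hv⟩ := Finite.exists_max g
  have hg : 0 < g v := by
    refine lt_of_lt_of_le ?_ (hv v0)
    have : (fun i => F (v0 i)) = b0 := funext hv0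
    simp only [g, this]
    rw [b0.det_self]; simp
  have hdet : b0.det (fun i => F (v i)) ≠ 0 := abs_pos.1 hg
  obtain ⟨hli, hsp⟩ := (Module.Basis.is_basis_iff_det b0).2 (isUnit_iff_ne_zero.2 hdet)
  let b1 := Module.Basis.mk hli hsp.ge
  have hb1 : ∀ i, b1 i = F (v i) := fun i => by simp [b1]
  have hcard : Fintype.card κ ≤ Fintype.card ι := by
    rw [← Module.finrank_eq_card_basis b0]
    simpa using Submodule.finrank_le W
  obtain ⟨e⟩ : Nonempty (κ ↪ ι) := Function.Embedding.nonempty_of_card_le hcard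
  obtain ⟨a0, ha0⟩ := hV
  refine ⟨fun i => if h : ∃ j, e j = i then (v h.choose : α) else a0, ?_, ?_⟩
  · intro i
    dsimp only
    split_ifs
    · exact (v _).2
    · exact ha0
  intro w hw
  have hcr : ∀ i, |b1.repr (F ⟨w, hw⟩) i| ≤ 1 := by
    intro i
    have h1 : b0.det (Function.update (fun i => F (v i)) i (F ⟨w, hw⟩)) =
        b1.repr (F ⟨w, hw⟩) i * b0.det (fun i => F (v i)) := by
      conv_lhs => rw [← b1.sum_repr (F ⟨w, hw⟩)]
      rw [AlternatingMap.map_update_sum, Finset.sum_eq_single i]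
      · rw [AlternatingMap.map_update_smul, hb1, smul_eq_mul, Function.update_eq_self]
      · intro j _ hj
        rw [AlternatingMap.map_update_smul, hb1, AlternatingMap.map_update_self _ _ hj.symm, smul_zero]
      · simp
    have h2 : (Function.update (fun i => F (v i)) i (F ⟨w, hw⟩)) =
        fun j => F (Function.update v i ⟨w, hw⟩ j) := by
      ext1 j
      by_cases h : j = i
      · subst h; simp
      · simp [h]
    have h3 := hv (Function.update v i ⟨w, hw⟩)
    simp only [g] at h3
    rw [← h2, h1, abs_mul] at h3
    have := abs_pos.2 hdet
    nlinarith
  refine ⟨fun i => if h : ∃ j, e j = i then b1.repr (F ⟨w, hw⟩) h.choose else 0, ?_, ?_⟩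
  · intro i
    dsimp only
    split_ifs
    · exact hcr _
    · simp
  have hs : f w = ∑ j, b1.repr (F ⟨w, hw⟩) j • f (v j) := by
    have := congrArg W.subtype (b1.sum_repr (F ⟨w, hw⟩))
    rw [map_sum] at this
    simpa [hb1, F] using this.symm
  rw [hs]
  symm
  rw [← Finset.sum_subset (Finset.subset_univ (Finset.univ.map e)), Finset.sum_map]
  · apply Finset.sum_congr rfl
    intro j _
    have h : ∃ j', e j' = e j := ⟨j, rfl⟩
    have h' : h.choose = j := e.injective h.choose_spec
    simp only [dif_pos h, h']
  · intro i _ hi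
    have : ¬ ∃ j, e j = i := by simpa using hi
    simp only [dif_neg this, zero_smul]

/-- real coordinates of a cube vertex -/
def cb {d : ℕ} (v : Fin d → Bool) (i : Fin d) : ℝ := if v i then 1 else 0

def Good {d : ℕ} {T : Type} [Fintype T] (K : Set (T → ℝ)) (V : Finset (Fin d → Bool)) : Prop :=
  ∃ E : (Fin d → Bool) → T → ℝ, (∀ w ∈ V, E w ∈ K ∧ ∀ τ, |E w τ| ≤ 2 ^ d) ∧
    ∀ (v : (T ⊕ Fin d ⊕ Unit) → Fin d → Bool), (∀ i, v i ∈ V) →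
    ∀ c : (T ⊕ Fin d ⊕ Unit) → ℝ, ∑ i, c i = 1 →
    ∀ w' : Fin d → Bool, (∀ j, ∑ i, c i * cb (v i) j = cb w' j) →
    ∀ Z ∈ K, (∀ τ, |∑ i, c i * E (v i) τ - Z τ| ≤ 1 / (2 * d * Fintype.card T)) → w' ∈ V

lemma core_sep {d : ℕ} {T : Type} [Fintype T] (K : Set (T → ℝ)) (V V' : Finset (Fin d → Bool))
    (E E' : (Fin d → Bool) → T → ℝ) (q : ℕ) (hq : 0 < q)
    (hqq : (Fintype.card (T ⊕ Fin d ⊕ Unit) : ℝ) * (2 * d * Fintype.card T) ≤ q)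
    (hd : 0 < d) (ht : 0 < Fintype.card T)
    (hE : (∀ w ∈ V, E w ∈ K ∧ ∀ τ, |E w τ| ≤ 2 ^ d))
    (hE' : (∀ w ∈ V', E' w ∈ K ∧ ∀ τ, |E' w τ| ≤ 2 ^ d))
    (h' : ∀ (v : (T ⊕ Fin d ⊕ Unit) → Fin d → Bool), (∀ i, v i ∈ V') →
    ∀ c : (T ⊕ Fin d ⊕ Unit) → ℝ, ∑ i, c i = 1 →
    ∀ w' : Fin d → Bool, (∀ j, ∑ i, c i * cb (v i) j = cb w' j) →
    ∀ Z ∈ K, (∀ τ, |∑ i, c i * E' (v i) τ - Z τ| ≤ 1 / (2 * d * Fintype.card T)) → w' ∈ V')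
    (v : (T ⊕ Fin d ⊕ Unit) → Fin d → Bool) (hv : ∀ i, v i ∈ V) (hv' : ∀ i, v i ∈ V')
    (hc : ∀ w ∈ V, ∃ c : (T ⊕ Fin d ⊕ Unit) → ℝ, (∀ i, |c i| ≤ 1) ∧
      (Sum.elim (E w) (Sum.elim (cb w) fun _ => 1) : (T ⊕ Fin d ⊕ Unit) → ℝ) =
        ∑ i, c i • Sum.elim (E (v i)) (Sum.elim (cb (v i)) fun _ => 1))
    (hfl : ∀ i τ, ⌊(E (v i) τ + 2 ^ d) * q⌋₊ = ⌊(E' (v i) τ + 2 ^ d) * q⌋₊) : V ⊆ V' := by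
  intro w hw
  obtain ⟨c, hc1, hc2⟩ := hc w hw
  have hT : ∀ τ, E w τ = ∑ i, c i * E (v i) τ := fun τ => by
    simpa using congrFun hc2 (Sum.inl τ)
  have hX : ∀ j, cb w j = ∑ i, c i * cb (v i) j := fun j => by
    simpa using congrFun hc2 (Sum.inr (Sum.inl j))
  have h1 : 1 = ∑ i, c i := by
    simpa using congrFun hc2 (Sum.inr (Sum.inr ()))
  refine h' v hv' c h1.symm w (fun j => (hX j).symm) (E w) (hE w hw).1 fun τ => ?_
  rw [hT, ← Finset.sum_sub_distrib]
  have hq' : (0 : ℝ) < q := by exact_mod_cast hq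
  have hdiff : ∀ i, |E' (v i) τ - E (v i) τ| ≤ 1 / q := by
    intro i
    have b1 := abs_le.1 ((hE _ (hv i)).2 τ)
    have b2 := abs_le.1 ((hE' _ (hv' i)).2 τ)
    have p1 : 0 ≤ (E (v i) τ + 2 ^ d) * q := mul_nonneg (by linarith [b1.1]) hq'.le
    have p2 : 0 ≤ (E' (v i) τ + 2 ^ d) * q := mul_nonneg (by linarith [b2.1]) hq'.le
    have f1 := Nat.floor_le p1
    have f2 := Nat.floor_le p2
    have f3 := Nat.lt_floor_add_one ((E (v i) τ + 2 ^ d) * q)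
    have f4 := Nat.lt_floor_add_one ((E' (v i) τ + 2 ^ d) * q)
    rw [hfl i τ] at f1 f3
    rw [le_div_iff₀ hq', ← abs_of_pos hq', ← abs_mul, abs_le]
    constructor <;> nlinarith
  calc |∑ i, (c i * E' (v i) τ - c i * E (v i) τ)|
      ≤ ∑ i, |c i * E' (v i) τ - c i * E (v i) τ| := Finset.abs_sum_le_sum_abs _ _
    _ ≤ ∑ i : (T ⊕ Fin d ⊕ Unit), (1 / q : ℝ) := by
        apply Finset.sum_le_sum
        intro i _
        rw [← mul_sub, abs_mul]
        calc _ ≤ 1 * (1 / q : ℝ) := mul_le_mul (hc1 i) (hdiff i) (abs_nonneg _) zero_le_one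
          _ = _ := one_mul _
    _ ≤ _ := by
        rw [Finset.sum_const, Finset.card_univ, nsmul_eq_mul, mul_one_div]
        have : (0 : ℝ) < 2 * d * Fintype.card T := by positivity
        rw [div_le_div_iff₀ hq' this]
        linarith

lemma core_num (d t : ℕ) (hd : 1 ≤ d) (ht : 1 ≤ t) (h : 81 * d ^ 2 * t ^ 2 ≤ 2 ^ d) :
    (2 ^ d) ^ (t + (d + 1)) *
      ((2 ^ (d + 1) * ((t + (d + 1)) * (2 * d * t)) + 1) ^ t) ^ (t + (d + 1)) < 2 ^ 2 ^ d - 1 := by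
  have hD : t + (d + 1) ≤ t * (d + 2) := by nlinarith
  have hq : (t + (d + 1)) * (2 * d * t) ≤ 2 ^ d := by
    refine le_trans ?_ h
    calc _ ≤ (t * (d + 2)) * (2 * d * t) := Nat.mul_le_mul_right _ hD
      _ = (2 * d ^ 2 + 4 * d) * t ^ 2 := by ring
      _ ≤ (81 * d ^ 2) * t ^ 2 := Nat.mul_le_mul_right _ (by nlinarith)
  have he : 2 ^ (d + 1) * ((t + (d + 1)) * (2 * d * t)) + 1 ≤ 2 ^ (2 * d + 2) := by
    calc _ ≤ 2 ^ (d + 1) * 2 ^ d + 2 ^ (2 * d + 1) :=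
          Nat.add_le_add (Nat.mul_le_mul_left _ hq) Nat.one_le_two_pow
      _ = _ := by ring
  have hx : d * (t + (d + 1)) + (2 * d + 2) * t * (t + (d + 1)) ≤ 2 ^ d - 2 := by
    have h2 : d * (t + (d + 1)) + (2 * d + 2) * t * (t + (d + 1)) ≤
        (3 * d ^ 2 + 8 * d + 4) * t ^ 2 := by
      calc _ = (d + (2 * d + 2) * t) * (t + (d + 1)) := by ring
        _ ≤ (d * t + (2 * d + 2) * t) * (t * (d + 2)) :=
          Nat.mul_le_mul (by nlinarith) hD
        _ = _ := by ring
    have h3 : (3 * d ^ 2 + 8 * d + 4) * t ^ 2 + 2 ≤ 81 * d ^ 2 * t ^ 2 := by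
      have : 1 ≤ t ^ 2 := Nat.one_le_pow _ _ ht
      have : 3 * d ^ 2 + 8 * d + 4 + 2 ≤ 81 * d ^ 2 := by nlinarith
      nlinarith
    omega
  calc _ ≤ (2 ^ d) ^ (t + (d + 1)) * ((2 ^ (2 * d + 2)) ^ t) ^ (t + (d + 1)) := by gcongr
    _ = 2 ^ (d * (t + (d + 1)) + (2 * d + 2) * t * (t + (d + 1))) := by
        rw [← pow_mul, ← pow_mul, ← pow_mul, ← pow_add, mul_assoc (2 * d + 2)]
    _ ≤ 2 ^ (2 ^ d - 2) := Nat.pow_le_pow_right (by norm_num) hx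
    _ < 2 ^ 2 ^ d - 1 := by
        have h4 : 2 ≤ 2 ^ d := by
          calc 2 = 2 ^ 1 := by norm_num
            _ ≤ _ := Nat.pow_le_pow_right (by norm_num) hd
        obtain ⟨m, hm⟩ := Nat.exists_eq_add_of_le h4
        rw [hm, pow_add]
        have : 1 ≤ 2 ^ m := Nat.one_le_two_pow
        have e : 2 + m - 2 = m := by omega
        rw [e]
        omega

lemma core {d : ℕ} {T : Type} [Fintype T] (K : Set (T → ℝ)) (hd : 1 ≤ d)
    (ht : 1 ≤ Fintype.card T) (h : 81 * d ^ 2 * Fintype.card T ^ 2 ≤ 2 ^ d) :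
    ∃ V : Finset (Fin d → Bool), V.Nonempty ∧ ¬ Good K V := by
  classical
  by_contra! hcon
  set ι := T ⊕ Fin d ⊕ Unit with hι
  have hcardι : Fintype.card ι = Fintype.card T + (d + 1) := by simp [hι]
  set q : ℕ := (Fintype.card T + (d + 1)) * (2 * d * Fintype.card T) with hqdef
  have hq : 0 < q := by positivity
  let A := {V : Finset (Fin d → Bool) // V.Nonempty}
  choose E hE hG using fun V : A => hcon V.1 V.2
  choose v hv hc using fun V : A => maxvol
    (fun w => (Sum.elim (E V w) (Sum.elim (cb w) fun _ => 1) : ι → ℝ)) V.1 V.2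
  let N := 2 ^ (d + 1) * q + 1
  have hN : ∀ (V : A) (i : ι) (τ : T), ⌊(E V (v V i) τ + 2 ^ d) * q⌋₊ < N := by
    intro V i τ
    have b1 := abs_le.1 ((hE V _ (hv V i)).2 τ)
    apply Nat.lt_succ_of_le
    apply Nat.floor_le_of_le
    push_cast
    have : (2 : ℝ) ^ (d + 1) = 2 ^ d + 2 ^ d := by ring
    rw [this]
    gcongr
    exact b1.2
  let data : A → (ι → Fin d → Bool) × (ι → T → Fin N) :=
    fun V => (v V, fun i τ => ⟨_, hN V i τ⟩)
  have hcard : Fintype.card ((ι → Fin d → Bool) × (ι → T → Fin N)) < Fintype.card A := by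
    have h1 : Fintype.card A = 2 ^ 2 ^ d - 1 := by
      have e1 : Fintype.card A = Fintype.card {V : Finset (Fin d → Bool) // ¬ V = ∅} :=
        Fintype.card_congr (Equiv.subtypeEquivRight fun V => Finset.nonempty_iff_ne_empty)
      rw [e1, Fintype.card_subtype_compl]
      simp
    rw [h1]
    have := core_num d (Fintype.card T) hd ht h
    simpa [hcardι, N] using this
  obtain ⟨V, V', hne, heq⟩ := Fintype.exists_ne_map_eq_of_card_lt data hcard
  have hveq : v V = v V' := congrArg Prod.fst heq
  have hfl : ∀ i τ, ⌊(E V (v V i) τ + 2 ^ d) * q⌋₊ = ⌊(E V' (v V' i) τ + 2 ^ d) * q⌋₊ :=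
    fun i τ => congrArg Fin.val (congrFun (congrFun (congrArg Prod.snd heq) i) τ)
  have hqq : (Fintype.card (T ⊕ Fin d ⊕ Unit) : ℝ) * (2 * d * Fintype.card T) ≤ q := by
    apply le_of_eq
    rw [hcardι, hqdef]
    push_cast
    ring
  apply hne
  apply Subtype.ext
  apply Finset.Subset.antisymm
  · exact core_sep K V.1 V'.1 (E V) (E V') q hq hqq hd ht (hE V) (hE V') (hG V') (v V) (hv V)
      (fun i => hveq ▸ hv V' i) (hc V) (fun i τ => by rw [hfl, hveq])
  · exact core_sep K V'.1 V.1 (E V') (E V) q hq hqq hd ht (hE V') (hE V) (hG V) (v V') (hv V')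
      (fun i => hveq ▸ hv V i) (hc V') (fun i τ => by rw [← hfl, hveq])
open Matrix
lemma psd_entry {k : ℕ} {Z : Matrix (Fin k) (Fin k) ℝ} (hZ : Z.PosSemidef) {N : ℝ}
    (hN : ∀ i, Z i i ≤ N) (i j : Fin k) : |Z i j| ≤ N := by
  have hsym : Z j i = Z i j := by
    have := congrFun (congrFun hZ.isHermitian i) j
    simpa [Matrix.conjTranspose_apply] using this
  have h1 := hZ.dotProduct_mulVec_nonneg (Pi.single i 1 + Pi.single j 1)
  have h2 := hZ.dotProduct_mulVec_nonneg (Pi.single i 1 - Pi.single j 1)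
  simp [Matrix.mulVec_add, Matrix.mulVec_sub, add_dotProduct, sub_dotProduct] at h1 h2
  have := hN i
  have := hN j
  rw [abs_le]
  constructor <;> linarith

lemma psd_factor {k : ℕ} {S : Matrix (Fin k) (Fin k) ℝ} (hS : S.PosSemidef) :
    ∃ C : Matrix (Fin k) (Fin k) ℝ, C * Cᵀ = S ∧ ∀ Y : Matrix (Fin k) (Fin k) ℝ, Y.PosSemidef →
      ∀ N : ℝ, 0 ≤ N → (∀ x : Fin k → ℝ, x ⬝ᵥ Y *ᵥ x ≤ N * (x ⬝ᵥ S *ᵥ x)) →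
      ∃ Z : Matrix (Fin k) (Fin k) ℝ, Z.PosSemidef ∧ C * Z * Cᵀ = Y ∧ ∀ i j, |Z i j| ≤ N := by
  obtain ⟨U, μ, hU, hU', hμ, hSU⟩ : ∃ (U : Matrix (Fin k) (Fin k) ℝ) (μ : Fin k → ℝ),
      Uᵀ * U = 1 ∧ U * Uᵀ = 1 ∧ (∀ i, 0 ≤ μ i) ∧ S = U * diagonal μ * Uᵀ := by
    refine ⟨hS.isHermitian.eigenvectorUnitary, hS.isHermitian.eigenvalues, ?_, ?_,
      hS.eigenvalues_nonneg, ?_⟩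
    · exact Unitary.coe_star_mul_self hS.isHermitian.eigenvectorUnitary
    · exact Unitary.coe_mul_star_self hS.isHermitian.eigenvectorUnitary
    · conv_lhs => rw [hS.isHermitian.spectral_theorem]
      rfl
  have hsq : ∀ i, √(μ i) * √(μ i) = μ i := fun i => Real.mul_self_sqrt (hμ i)
  refine ⟨U * diagonal (fun i => √(μ i)), ?_, ?_⟩
  · rw [transpose_mul, diagonal_transpose, hSU, Matrix.mul_assoc, ← Matrix.mul_assoc (diagonal _),
      diagonal_mul_diagonal, ← Matrix.mul_assoc]
    simp [hsq]
  intro Y hY N hN hle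
  set X := Uᵀ * Y * U with hX
  have hXp : X.PosSemidef := by
    have := hY.conjTranspose_mul_mul_same U
    simpa [hX] using this
  have hq : ∀ i, X i i ≤ N * μ i := by
    intro i
    have := hle (U *ᵥ Pi.single i 1)
    have e : ∀ A : Matrix (Fin k) (Fin k) ℝ, (U *ᵥ Pi.single i 1) ⬝ᵥ A *ᵥ (U *ᵥ Pi.single i 1)
        = (Uᵀ * A * U) i i := by
      intro A
      rw [mulVec_mulVec, dotProduct_mulVec, ← mulVec_transpose, mulVec_mulVec, transpose_mul,
        dotProduct_comm, dotProduct_mulVec, ← mulVec_transpose]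
      simp [Matrix.mul_assoc]
    rw [e, e, hSU] at this
    have e2 : Uᵀ * (U * diagonal μ * Uᵀ) * U = diagonal μ := by
      rw [Matrix.mul_assoc, Matrix.mul_assoc, hU, Matrix.mul_one, ← Matrix.mul_assoc, hU,
        Matrix.one_mul]
    rw [e2] at this
    simpa using this
  have hsymX : ∀ i j, X i j = X j i := by
    intro i j
    have := congrFun (congrFun hXp.isHermitian i) j
    simpa [Matrix.conjTranspose_apply] using this.symm
  have hz : ∀ i, μ i = 0 → ∀ j, X j i = 0 := by
    intro i hi j
    have h0 : X i i = 0 := le_antisymm (by simpa [hi] using hq i) hXp.diag_nonneg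
    have h1 := (hXp.dotProduct_mulVec_zero_iff (Pi.single i 1)).1 (by simpa using h0)
    simpa using congrFun h1 j
  set R : Matrix (Fin k) (Fin k) ℝ := diagonal (fun i => (√(μ i))⁻¹) with hR
  have hZp : (R * X * R).PosSemidef := by
    have := hXp.conjTranspose_mul_mul_same R
    simpa [hR, diagonal_conjTranspose] using this
  refine ⟨R * X * R, hZp, ?_, psd_entry hZp ?_⟩
  · have e3 : diagonal (fun i => √(μ i)) * (R * X * R) * diagonal (fun i => √(μ i)) = X := by
      ext i j
      rw [hR, mul_diagonal, diagonal_mul, mul_diagonal, diagonal_mul]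
      by_cases hi : μ i = 0
      · rw [hsymX i j, hz i hi j]; simp
      by_cases hj : μ j = 0
      · rw [hz j hj i]; simp
      have hi' : √(μ i) ≠ 0 := by rw [Real.sqrt_ne_zero (hμ i)]; exact hi
      have hj' : √(μ j) ≠ 0 := by rw [Real.sqrt_ne_zero (hμ j)]; exact hj
      field_simp
    rw [transpose_mul, diagonal_transpose]
    calc _ = U * (diagonal (fun i => √(μ i)) * (R * X * R) * diagonal (fun i => √(μ i))) * Uᵀ := by
          simp only [Matrix.mul_assoc]
      _ = (U * Uᵀ) * Y * (U * Uᵀ) := by rw [e3, hX]; simp only [Matrix.mul_assoc]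
      _ = Y := by rw [hU']; simp
  · intro i
    rw [hR, mul_diagonal, diagonal_mul]
    by_cases hi : μ i = 0
    · simp [hi, hN]
    have hp : 0 < μ i := lt_of_le_of_ne (hμ i) (Ne.symm hi)
    have := hq i
    have e : (√(μ i))⁻¹ * X i i * (√(μ i))⁻¹ = X i i / μ i := by
      rw [← hsq i]
      have : √(μ i) ≠ 0 := by positivity
      rw [hsq i]
      field_simp
      rw [Real.sq_sqrt hp.le]
      ring
    rw [e, div_le_iff₀ hp]
    exact this

lemma psd_perturb {k : ℕ} {A Z : Matrix (Fin k) (Fin k) ℝ} (hA : A.IsSymm) (hZ : Z.PosSemidef)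
    {η δ : ℝ} (hη : 0 ≤ η) (h : ∀ i j, |A i j - Z i j| ≤ η) (hδ : k * η ≤ δ) :
    (A + δ • (1 : Matrix (Fin k) (Fin k) ℝ)).PosSemidef := by
  apply PosSemidef.of_dotProduct_mulVec_nonneg
  · have : (A + δ • (1 : Matrix (Fin k) (Fin k) ℝ))ᵀ = A + δ • 1 := by
      rw [transpose_add, hA, transpose_smul, transpose_one]
    simpa [IsHermitian, conjTranspose_eq_transpose_of_trivial] using this
  intro x
  have h0 := hZ.dotProduct_mulVec_nonneg x
  simp only [star_trivial] at h0 ⊢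
  have e : x ⬝ᵥ (A + δ • (1 : Matrix (Fin k) (Fin k) ℝ)) *ᵥ x =
      x ⬝ᵥ Z *ᵥ x + (x ⬝ᵥ (A - Z) *ᵥ x + δ * ∑ i, x i ^ 2) := by
    rw [add_mulVec, sub_mulVec, dotProduct_add, dotProduct_sub, smul_mulVec, one_mulVec,
      dotProduct_smul, smul_eq_mul]
    have : x ⬝ᵥ x = ∑ i, x i ^ 2 := by simp [dotProduct, sq]
    rw [this]; ring
  rw [e]
  have h1 : |x ⬝ᵥ (A - Z) *ᵥ x| ≤ η * (∑ i, |x i|) ^ 2 := by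
    simp only [dotProduct, mulVec]
    calc _ ≤ ∑ i, |x i * ∑ j, (A - Z) i j * x j| := Finset.abs_sum_le_sum_abs _ _
      _ ≤ ∑ i, |x i| * ∑ j, η * |x j| := by
          gcongr with i
          rw [abs_mul]
          gcongr
          refine (Finset.abs_sum_le_sum_abs _ _).trans ?_
          gcongr with j
          rw [abs_mul]
          gcongr
          exact h i j
      _ = _ := by
          rw [← Finset.mul_sum, ← Finset.sum_mul]; ring
  have h2 : (∑ i, |x i|) ^ 2 ≤ k * ∑ i, x i ^ 2 := by
    have := sq_sum_le_card_mul_sum_sq (s := Finset.univ) (f := fun i => |x i|)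
    simpa using this
  have h3 := (abs_le.1 h1).1
  have h4 : 0 ≤ ∑ i, x i ^ 2 := by positivity
  nlinarith [mul_le_mul_of_nonneg_left h2 hη, mul_le_mul_of_nonneg_right hδ h4]

def pt {d : ℕ} (v : Fin d → Bool) : EuclideanSpace ℝ (Fin d) := WithLp.toLp 2 (cb v)

def PV {d : ℕ} (V : Finset (Fin d → Bool)) : Set (EuclideanSpace ℝ (Fin d)) :=
  convexHull ℝ (pt '' (V : Set (Fin d → Bool)))

lemma PV_zo {d : ℕ} (V : Finset (Fin d → Bool)) : IsZeroOnePolytope (PV V) := by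
  refine ⟨_, ?_, rfl⟩
  rintro _ ⟨v, _, rfl⟩ i
  show cb v i = 0 ∨ cb v i = 1
  unfold cb
  split_ifs <;> simp

lemma aff_sum {E F ι : Type*} [AddCommGroup E] [Module ℝ E] [AddCommGroup F] [Module ℝ F]
    (f : E →ᵃ[ℝ] F) (s : Finset ι) (c : ι → ℝ) (y : ι → E) (h : ∑ i ∈ s, c i = 1) :
    f (∑ i ∈ s, c i • y i) = ∑ i ∈ s, c i • f (y i) := by
  have hd : ∀ x, f x = f.linear x + f 0 := fun x => congrFun f.decomp x
  rw [hd, map_sum]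
  simp_rw [map_smul]
  rw [Finset.sum_congr rfl (fun i _ => by rw [hd (y i), smul_add] :
    ∀ i ∈ s, c i • f (y i) = c i • f.linear (y i) + c i • f 0), Finset.sum_add_distrib,
    ← Finset.sum_smul, h, one_smul]

lemma aff_two {E F : Type*} [AddCommGroup E] [Module ℝ E] [AddCommGroup F] [Module ℝ F]
    (f : E →ᵃ[ℝ] F) (a b : ℝ) (x y : E) (h : a + b = 1) :
    f (a • x + b • y) = a • f x + b • f y := by
  have := aff_sum f Finset.univ ![a, b] ![x, y] (by simpa using h)
  simpa using this

/-- Hamming distance to `w`, extended affinely -/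
def ham {d : ℕ} (w : Fin d → Bool) (x : EuclideanSpace ℝ (Fin d)) : ℝ :=
  ∑ i, if w i then 1 - x i else x i

lemma ham_two {d : ℕ} (w : Fin d → Bool) (a b : ℝ) (x y : EuclideanSpace ℝ (Fin d))
    (h : a + b = 1) : ham w (a • x + b • y) = a * ham w x + b * ham w y := by
  unfold ham
  rw [Finset.mul_sum, Finset.mul_sum, ← Finset.sum_add_distrib]
  refine Finset.sum_congr rfl fun i _ => ?_
  have hb : b = 1 - a := by linarith
  split_ifs
  · simp; rw [hb]; ring
  · simp

lemma ham_self {d : ℕ} (w : Fin d → Bool) : ham w (pt w) = 0 := by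
  unfold ham
  refine Finset.sum_eq_zero fun i _ => ?_
  by_cases h : w i <;> simp [pt, cb, h]

lemma ham_le {d : ℕ} (w v : Fin d → Bool) : ham w (pt v) ≤ d := by
  unfold ham
  calc _ ≤ ∑ i : Fin d, (1 : ℝ) := by
        refine Finset.sum_le_sum fun i _ => ?_
        by_cases h : w i <;> by_cases h' : v i <;> simp [pt, cb, h, h']
    _ = d := by simp

lemma ham_ge {d : ℕ} (w v : Fin d → Bool) (hne : v ≠ w) : 1 ≤ ham w (pt v) := by
  obtain ⟨i, hi⟩ := Function.ne_iff.1 hne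
  unfold ham
  have h0 : ∀ j ∈ Finset.univ, (0 : ℝ) ≤ if w j then 1 - pt v j else pt v j := by
    intro j _
    by_cases h : w j <;> by_cases h' : v j <;> simp [pt, cb, h, h']
  refine le_trans ?_ (Finset.single_le_sum h0 (Finset.mem_univ i))
  by_cases h : w i <;> by_cases h' : v i <;> simp_all [pt, cb]

lemma ham_PV {d : ℕ} (V : Finset (Fin d → Bool)) (w : Fin d → Bool) (x : EuclideanSpace ℝ (Fin d))
    (hx : x ∈ PV V) : ham w x ≤ d ∧ (w ∉ V → 1 ≤ ham w x) := by
  constructor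
  · have hc : Convex ℝ {x | ham w x ≤ d} := by
      intro x hx y hy a b ha hb hab
      simp only [Set.mem_ofPred_eq] at *
      rw [ham_two w a b x y hab]
      nlinarith [mul_le_mul_of_nonneg_left hx ha, mul_le_mul_of_nonneg_left hy hb]
    refine convexHull_min ?_ hc hx
    rintro _ ⟨v, _, rfl⟩
    exact ham_le w v
  · intro hw
    have hc : Convex ℝ {x | 1 ≤ ham w x} := by
      intro x hx y hy a b ha hb hab
      simp only [Set.mem_ofPred_eq] at *
      rw [ham_two w a b x y hab]
      nlinarith [mul_le_mul_of_nonneg_left hx ha, mul_le_mul_of_nonneg_left hy hb]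
    refine convexHull_min ?_ hc hx
    rintro _ ⟨v, hv, rfl⟩
    exact ham_ge w v (fun h => hw (h ▸ hv))

lemma geo {d n : ℕ} (hd : 1 ≤ d) {V : Finset (Fin d → Bool)} (hV : V.Nonempty)
    (φ : EuclideanSpace ℝ (Fin n) →ᵃ[ℝ] EuclideanSpace ℝ (Fin d))
    (y : (Fin d → Bool) → EuclideanSpace ℝ (Fin n)) (hφ : ∀ w ∈ V, φ (y w) = pt w)
    {ι : Type*} [Fintype ι] (v : ι → Fin d → Bool) (hv : ∀ i, v i ∈ V) (c : ι → ℝ)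
    (hc : ∑ i, c i = 1) (w' : Fin d → Bool) (hw' : ∀ j, ∑ i, c i * cb (v i) j = cb w' j)
    (δ : ℝ) (hδ : δ = 1 / (2 * d))
    (h : φ ((1 / (1 + δ)) • (∑ i, c i • y (v i)) +
      (δ / (1 + δ)) • (∑ w ∈ V, (1 / (V.card : ℝ)) • y w)) ∈ PV V) : w' ∈ V := by
  have hd' : (1 : ℝ) ≤ d := by exact_mod_cast hd
  have hδ0 : 0 < δ := by rw [hδ]; positivity
  have hcard : (0 : ℝ) < V.card := by exact_mod_cast hV.card_pos
  have hsum : ∑ w ∈ V, (1 / (V.card : ℝ)) = 1 := by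
    rw [Finset.sum_const, nsmul_eq_mul]; field_simp
  have hab : 1 / (1 + δ) + δ / (1 + δ) = 1 := by field_simp
  rw [aff_two φ _ _ _ _ hab, aff_sum φ _ c _ hc, aff_sum φ _ _ _ hsum] at h
  have h1 : ∑ i, c i • φ (y (v i)) = pt w' := by
    ext j
    simp only [hφ _ (hv _)]
    have := hw' j
    simpa [pt] using this
  have h2 : ∑ w ∈ V, (1 / (V.card : ℝ)) • φ (y w) ∈ PV V := by
    refine (convex_convexHull ℝ _).sum_mem (fun _ _ => by positivity) hsum fun w hw => ?_
    rw [hφ w hw]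
    exact subset_convexHull ℝ _ ⟨w, hw, rfl⟩
  by_contra hw
  have h3 := (ham_PV V w' _ h).2 hw
  rw [h1, ham_two _ _ _ _ _ hab, ham_self] at h3
  have h4 := (ham_PV V w' _ h2).1
  set X := ham w' (∑ w ∈ V, (1 / (V.card : ℝ)) • φ (y w))
  have h5 : δ * X ≤ δ * d := mul_le_mul_of_nonneg_left h4 hδ0.le
  have h6 : δ * d = 1 / 2 := by rw [hδ]; field_simp
  have h7 : 1 / (1 + δ) * 0 + δ / (1 + δ) * X = δ * X / (1 + δ) := by ring
  rw [h7, le_div_iff₀ (by linarith)] at h3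
  linarith

lemma good_lin {d l : ℕ} (hd : 1 ≤ d) (hl : 1 ≤ l) {V : Finset (Fin d → Bool)} (hV : V.Nonempty)
    (h : HasLinExt (PV V) l) : Good (T := Fin l) {z | ∀ i, 0 ≤ z i} V := by
  obtain ⟨n, φ, a, hP⟩ := h
  have hd' : (1 : ℝ) ≤ d := by exact_mod_cast hd
  have hl' : (1 : ℝ) ≤ l := by exact_mod_cast hl
  have hex : ∀ w : Fin d → Bool, ∃ y, w ∈ V → (∀ i, 0 ≤ a i y) ∧ φ y = pt w := by
    intro w
    by_cases hw : w ∈ V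
    · have : pt w ∈ PV V := subset_convexHull ℝ _ ⟨w, hw, rfl⟩
      rw [hP] at this
      obtain ⟨y, hy, hy2⟩ := this
      exact ⟨y, fun _ => ⟨hy, hy2⟩⟩
    · exact ⟨0, fun h => absurd h hw⟩
  choose y hy using hex
  have hcard : (0 : ℝ) < V.card := by exact_mod_cast hV.card_pos
  have hsum : ∑ w ∈ V, (1 / (V.card : ℝ)) = 1 := by
    rw [Finset.sum_const, nsmul_eq_mul]; field_simp
  have hcard2 : (V.card : ℝ) ≤ 2 ^ d := by
    have := Finset.card_le_univ V
    simp at this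
    exact_mod_cast this
  set yb := ∑ w ∈ V, (1 / (V.card : ℝ)) • y w with hyb
  have hab : ∀ i, V.card * a i yb = ∑ w ∈ V, a i (y w) := by
    intro i
    rw [hyb, aff_sum _ _ _ _ hsum, ← Finset.smul_sum, smul_eq_mul]
    field_simp
  have hb0 : ∀ i, 0 ≤ a i yb := by
    intro i
    have : 0 ≤ ∑ w ∈ V, a i (y w) := Finset.sum_nonneg fun w hw => (hy w hw).1 i
    rw [← hab] at this
    exact nonneg_of_mul_nonneg_right this hcard
  have hle : ∀ w ∈ V, ∀ i, a i (y w) ≤ 2 ^ d * a i yb := by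
    intro w hw i
    calc _ ≤ ∑ w ∈ V, a i (y w) :=
          Finset.single_le_sum (f := fun w => a i (y w)) (fun w hw => (hy w hw).1 i) hw
      _ = V.card * a i yb := (hab i).symm
      _ ≤ _ := mul_le_mul_of_nonneg_right hcard2 (hb0 i)
  have hmul : ∀ w ∈ V, ∀ i, a i (y w) = a i yb * (a i (y w) / a i yb) := by
    intro w hw i
    by_cases h0 : a i yb = 0
    · have := hle w hw i
      have := (hy w hw).1 i
      simp only [h0] at *
      linarith
    · field_simp
  refine ⟨fun w i => a i (y w) / a i yb, ?_, ?_⟩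
  · intro w hw
    have hnn : ∀ i, 0 ≤ a i (y w) / a i yb := fun i => div_nonneg ((hy w hw).1 i) (hb0 i)
    refine ⟨hnn, fun i => ?_⟩
    rw [abs_of_nonneg (hnn i)]
    exact div_le_of_le_mul₀ (hb0 i) (by positivity) (hle w hw i)
  intro v hv c hc w' hw' Z hZ hclose
  refine geo hd hV φ y (fun w hw => (hy w hw).2) v hv c hc w' hw' _ rfl ?_
  rw [hP]
  refine ⟨_, ?_, rfl⟩
  intro i
  set δ : ℝ := 1 / (2 * d) with hδ
  have hδ0 : 0 < δ := by positivity
  rw [aff_two (a i) _ _ _ _ (by field_simp), aff_sum _ _ _ _ hc, ← hyb]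
  have e : ∑ j, c j • a i (y (v j)) = a i yb * ∑ j, c j * (a i (y (v j)) / a i yb) := by
    rw [Finset.mul_sum]
    refine Finset.sum_congr rfl fun j _ => ?_
    rw [smul_eq_mul]
    conv_lhs => rw [hmul _ (hv j) i]
    ring
  rw [e]
  have h1 := (abs_le.1 (hclose i)).1
  have h2 : 0 ≤ Z i := hZ i
  have h3 : 1 / (2 * d * (Fintype.card (Fin l)) : ℝ) ≤ δ := by
    rw [Fintype.card_fin, hδ]
    apply one_div_le_one_div_of_le (by positivity)
    nlinarith
  simp only [smul_eq_mul]
  have h4 : 0 ≤ ∑ j, c j * (a i (y (v j)) / a i yb) + δ := by linarith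
  calc 0 ≤ (1 / (1 + δ)) * (a i yb * (∑ j, c j * (a i (y (v j)) / a i yb) + δ)) := by
        have := hb0 i
        positivity
    _ = _ := by ring

lemma good_sdp {d k : ℕ} (hd : 1 ≤ d) (hk : 1 ≤ k) {V : Finset (Fin d → Bool)} (hV : V.Nonempty)
    (h : HasSdpExt (PV V) k) :
    Good (T := Fin k × Fin k) {z | (Matrix.of fun i j => z (i, j)).PosSemidef} V := by
  obtain ⟨n, φ, M, hsym, hP⟩ := h
  have hd' : (1 : ℝ) ≤ d := by exact_mod_cast hd
  have hk' : (1 : ℝ) ≤ k := by exact_mod_cast hk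
  have hex : ∀ w : Fin d → Bool, ∃ y, w ∈ V → (M y).PosSemidef ∧ φ y = pt w := by
    intro w
    by_cases hw : w ∈ V
    · have : pt w ∈ PV V := subset_convexHull ℝ _ ⟨w, hw, rfl⟩
      rw [hP] at this
      obtain ⟨y, hy, hy2⟩ := this
      exact ⟨y, fun _ => ⟨hy, hy2⟩⟩
    · exact ⟨0, fun h => absurd h hw⟩
  choose y hy using hex
  have hcard : (0 : ℝ) < V.card := by exact_mod_cast hV.card_pos
  have hsum : ∑ w ∈ V, (1 / (V.card : ℝ)) = 1 := by
    rw [Finset.sum_const, nsmul_eq_mul]; field_simp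
  have hcard2 : (V.card : ℝ) ≤ 2 ^ d := by
    have := Finset.card_le_univ V
    simp at this
    exact_mod_cast this
  set yb := ∑ w ∈ V, (1 / (V.card : ℝ)) • y w with hyb
  have hMb : M yb = (1 / (V.card : ℝ)) • ∑ w ∈ V, M (y w) := by
    rw [hyb, aff_sum _ _ _ _ hsum, ← Finset.smul_sum]
  have hb0 : (M yb).PosSemidef := by
    rw [hMb]
    exact (posSemidef_sum _ fun w hw => (hy w hw).1).smul (by positivity)
  have hle : ∀ w ∈ V, ∀ x : Fin k → ℝ, x ⬝ᵥ M (y w) *ᵥ x ≤ 2 ^ d * (x ⬝ᵥ M yb *ᵥ x) := by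
    intro w hw x
    calc _ ≤ ∑ w ∈ V, x ⬝ᵥ M (y w) *ᵥ x :=
          Finset.single_le_sum (f := fun w => x ⬝ᵥ M (y w) *ᵥ x)
            (fun w hw => by simpa using (hy w hw).1.dotProduct_mulVec_nonneg x) hw
      _ = V.card * (x ⬝ᵥ M yb *ᵥ x) := by
          rw [hMb, smul_mulVec, dotProduct_smul, sum_mulVec, dotProduct_sum, smul_eq_mul]
          field_simp
      _ ≤ _ := mul_le_mul_of_nonneg_right hcard2 (by simpa using hb0.dotProduct_mulVec_nonneg x)
  obtain ⟨C, hC, hfac⟩ := psd_factor hb0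
  have hexZ : ∀ w : Fin d → Bool, ∃ Z : Matrix (Fin k) (Fin k) ℝ,
      w ∈ V → Z.PosSemidef ∧ C * Z * Cᵀ = M (y w) ∧ ∀ i j, |Z i j| ≤ 2 ^ d := by
    intro w
    by_cases hw : w ∈ V
    · obtain ⟨Z, hZ⟩ := hfac _ (hy w hw).1 (2 ^ d) (by positivity) (hle w hw)
      exact ⟨Z, fun _ => hZ⟩
    · exact ⟨0, fun h => absurd h hw⟩
  choose Y hY using hexZ
  refine ⟨fun w τ => Y w τ.1 τ.2, ?_, ?_⟩
  · intro w hw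
    exact ⟨(hY w hw).1, fun τ => (hY w hw).2.2 _ _⟩
  intro v hv c hc w' hw' Z hZ hclose
  refine geo hd hV φ y (fun w hw => (hy w hw).2) v hv c hc w' hw' _ rfl ?_
  rw [hP]
  refine ⟨_, ?_, rfl⟩
  set δ : ℝ := 1 / (2 * d) with hδ
  have hδ0 : 0 < δ := by positivity
  rw [Set.mem_ofPred_eq, aff_two M _ _ _ _ (by field_simp), aff_sum _ _ _ _ hc, ← hyb]
  set A := ∑ j, c j • Y (v j) with hA
  have e : ∑ j, c j • M (y (v j)) = C * A * Cᵀ := by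
    rw [hA, Finset.mul_sum, Finset.sum_mul]
    refine Finset.sum_congr rfl fun j _ => ?_
    rw [Matrix.mul_smul, Matrix.smul_mul, (hY _ (hv j)).2.1]
  have hAs : A.IsSymm := by
    rw [IsSymm, hA, transpose_sum]
    refine Finset.sum_congr rfl fun j _ => ?_
    rw [transpose_smul]
    congr 1
    have := (hY _ (hv j)).1.isHermitian
    rwa [IsHermitian, conjTranspose_eq_transpose_of_trivial] at this
  have hp : (A + δ • (1 : Matrix (Fin k) (Fin k) ℝ)).PosSemidef := by
    refine psd_perturb (η := 1 / (2 * d * Fintype.card (Fin k × Fin k))) hAs hZ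
      (by positivity) (fun i j => ?_) ?_
    · have := hclose (i, j)
      rw [hA, Matrix.sum_apply]
      simpa using this
    · rw [Fintype.card_prod, Fintype.card_fin, hδ]
      push_cast
      have : (k : ℝ) * (1 / (2 * d * (k * k))) = 1 / (2 * d * k) := by field_simp
      rw [this]
      apply one_div_le_one_div_of_le (by positivity)
      nlinarith
  have hp2 := (hp.conjTranspose_mul_mul_same Cᵀ).smul (a := 1 / (1 + δ)) (by positivity)
  convert hp2 using 1
  rw [e, ← hC, conjTranspose_eq_transpose_of_trivial, transpose_transpose, Matrix.mul_add,
    Matrix.add_mul, smul_add, Matrix.mul_smul, Matrix.smul_mul, Matrix.mul_one, smul_smul]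
  congr 2
  ring

lemma sdp_point {d : ℕ} (p : EuclideanSpace ℝ (Fin d)) (k : ℕ) : HasSdpExt {p} k := by
  refine ⟨0, AffineMap.const ℝ _ p, AffineMap.const ℝ _ 0, fun x => ?_, ?_⟩
  · simp [IsSymm]
  · ext x
    simp only [mem_singleton_iff, mem_image, AffineMap.const_apply]
    constructor
    · rintro rfl
      exact ⟨0, PosSemidef.zero, rfl⟩
    · rintro ⟨_, _, rfl⟩
      rfl

lemma lin_point {d : ℕ} (p : EuclideanSpace ℝ (Fin d)) (k : ℕ) : HasLinExt {p} k := by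
  refine ⟨0, AffineMap.const ℝ _ p, fun _ => AffineMap.const ℝ _ 0, ?_⟩
  ext x
  simp only [mem_singleton_iff, mem_image, AffineMap.const_apply]
  constructor
  · rintro rfl
    exact ⟨0, fun _ => le_rfl, rfl⟩
  · rintro ⟨_, _, rfl⟩
    rfl

lemma lin_mono {d : ℕ} {P : Set (EuclideanSpace ℝ (Fin d))} {j k : ℕ} (hjk : j ≤ k)
    (h : HasLinExt P j) : HasLinExt P k := by
  obtain ⟨n, φ, a, rfl⟩ := h
  refine ⟨n, φ, fun i => if hi : i.1 < j then a ⟨i, hi⟩ else AffineMap.const ℝ _ 0, ?_⟩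
  congr 1
  ext x
  constructor
  · intro hx i
    dsimp only
    split_ifs with hi
    · exact hx _
    · simp
  · intro hx i
    have := hx ⟨i, i.2.trans_le hjk⟩
    simpa using this

lemma sdp_mono {d : ℕ} {P : Set (EuclideanSpace ℝ (Fin d))} {j k : ℕ} (hjk : j ≤ k)
    (h : HasSdpExt P j) : HasSdpExt P k := by
  obtain ⟨n, φ, M, hs, rfl⟩ := h
  let B : Matrix (Fin k) (Fin j) ℝ := Matrix.of fun a b => if a = Fin.castLE hjk b then 1 else 0
  have hB : Bᵀ * B = 1 := by
    ext a b
    simp [B, Matrix.mul_apply, Matrix.one_apply, eq_comm]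
  let L : Matrix (Fin j) (Fin j) ℝ →ₗ[ℝ] Matrix (Fin k) (Fin k) ℝ :=
    { toFun := fun X => B * X * Bᵀ
      map_add' := fun X Y => by rw [Matrix.mul_add, Matrix.add_mul]
      map_smul' := fun r X => by simp }
  have hL : ∀ x, (L.toAffineMap.comp M) x = B * M x * Bᵀ := fun x => rfl
  refine ⟨n, φ, L.toAffineMap.comp M, fun x => ?_, ?_⟩
  · rw [hL, IsSymm, transpose_mul, transpose_mul, transpose_transpose, (hs x).eq, Matrix.mul_assoc]
  · congr 1
    ext x
    simp only [Set.mem_ofPred_eq]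
    rw [hL]
    constructor
    · intro hx
      have := hx.conjTranspose_mul_mul_same Bᵀ
      rwa [conjTranspose_eq_transpose_of_trivial, transpose_transpose] at this
    · intro hx
      have := hx.conjTranspose_mul_mul_same B
      rw [conjTranspose_eq_transpose_of_trivial] at this
      have e : Bᵀ * (B * M x * Bᵀ) * B = M x := by
        calc _ = (Bᵀ * B) * M x * (Bᵀ * B) := by simp only [Matrix.mul_assoc]
          _ = M x := by rw [hB]; simp
      rwa [e] at this

lemma lin_to_sdp {d : ℕ} {P : Set (EuclideanSpace ℝ (Fin d))} {l : ℕ}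
    (h : HasLinExt P l) : HasSdpExt P l := by
  obtain ⟨n, φ, a, rfl⟩ := h
  let L : (Fin l → ℝ) →ₗ[ℝ] Matrix (Fin l) (Fin l) ℝ := Matrix.diagonalLinearMap (Fin l) ℝ ℝ
  have hL : ∀ x, (L.toAffineMap.comp (AffineMap.pi a)) x = Matrix.diagonal (fun i => a i x) :=
    fun x => rfl
  refine ⟨n, φ, L.toAffineMap.comp (AffineMap.pi a), fun x => ?_, ?_⟩
  · rw [hL, IsSymm, diagonal_transpose]
  · congr 1
    ext x
    simp only [Set.mem_ofPred_eq]
    rw [hL, posSemidef_diagonal_iff]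

lemma lin_exists {d : ℕ} (V : Finset (Fin d → Bool)) : ∃ l, HasLinExt (PV V) l := by
  classical
  set s : Finset (EuclideanSpace ℝ (Fin d)) := V.image pt with hs
  have hPV : PV V = convexHull ℝ (s : Set (EuclideanSpace ℝ (Fin d))) := by
    rw [hs, Finset.coe_image]; rfl
  let e : Fin s.card ≃ s := s.equivFin.symm
  let J := Fin s.card ⊕ Bool
  let pr : Fin s.card → (EuclideanSpace ℝ (Fin s.card) →ₗ[ℝ] ℝ) :=
    fun i => (EuclideanSpace.proj i : EuclideanSpace ℝ (Fin s.card) →L[ℝ] ℝ).toLinearMap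
  have hpr : ∀ i x, pr i x = x i := fun i x => rfl
  let S : EuclideanSpace ℝ (Fin s.card) →ₗ[ℝ] ℝ := ∑ i, pr i
  have hS : ∀ x, S x = ∑ i, x i := fun x => by simp [S, hpr]
  let one : EuclideanSpace ℝ (Fin s.card) →ᵃ[ℝ] ℝ := AffineMap.const ℝ _ 1
  let b : J → (EuclideanSpace ℝ (Fin s.card) →ᵃ[ℝ] ℝ) :=
    Sum.elim (fun i => (pr i).toAffineMap)
      (fun t => if t then S.toAffineMap - one else one - S.toAffineMap)
  let Φ : EuclideanSpace ℝ (Fin s.card) →ₗ[ℝ] EuclideanSpace ℝ (Fin d) :=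
    ∑ i, (pr i).smulRight (e i : EuclideanSpace ℝ (Fin d))
  have hΦ : ∀ x, Φ x = ∑ i, x i • (e i : EuclideanSpace ℝ (Fin d)) := fun x => by
    simp [Φ, hpr]
  have hb : ∀ x, (∀ j : J, 0 ≤ b j x) ↔ (∀ i, 0 ≤ x i) ∧ ∑ i, x i = 1 := by
    intro x
    rw [Sum.forall]
    refine and_congr Iff.rfl ?_
    have h1 : b (Sum.inr true) x = S x - 1 := by simp [b, one]
    have h2 : b (Sum.inr false) x = 1 - S x := by simp [b, one]
    rw [Bool.forall_bool, h1, h2, hS]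
    constructor
    · rintro ⟨p, q⟩; linarith
    · intro h; constructor <;> linarith
  refine ⟨Fintype.card J, s.card, Φ.toAffineMap, fun i => b ((Fintype.equivFin J).symm i), ?_⟩
  rw [hPV]
  ext p
  rw [Finset.mem_convexHull']
  have hfe : ∀ x, (∀ i, 0 ≤ b ((Fintype.equivFin J).symm i) x) ↔
      (∀ i, 0 ≤ x i) ∧ ∑ i, x i = 1 := by
    intro x
    rw [← hb]
    exact (Fintype.equivFin J).symm.forall_congr_right (q := fun j => 0 ≤ b j x)
  have hsum : ∀ {F : Type} [AddCommMonoid F] (g : EuclideanSpace ℝ (Fin d) → F),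
      ∑ y ∈ s, g y = ∑ i, g (e i) := by
    intro F _ g
    rw [← Finset.sum_coe_sort, ← e.sum_comp (fun y : s => g y)]
  constructor
  · rintro ⟨w, hw0, hw1, hw2⟩
    refine ⟨WithLp.toLp 2 fun i => w (e i), (hfe _).2 ⟨fun i => hw0 _ (e i).2, ?_⟩, ?_⟩
    · rw [← hw1, hsum]
    · rw [← hw2, hsum]
      exact hΦ _
  · rintro ⟨x, hx, rfl⟩
    obtain ⟨h0, h1⟩ := (hfe x).1 hx
    refine ⟨fun y => if hy : y ∈ s then x (e.symm ⟨y, hy⟩) else 0, ?_, ?_, ?_⟩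
    · intro y hy
      simp only [hy, dif_pos]
      exact h0 _
    · rw [hsum, ← h1]
      refine Finset.sum_congr rfl fun i _ => ?_
      simp
    · rw [hsum]
      refine Eq.trans ?_ (hΦ x).symm
      refine Finset.sum_congr rfl fun i _ => ?_
      simp

lemma PV_nonempty {d : ℕ} {V : Finset (Fin d → Bool)} (hV : V.Nonempty) : PV V ≠ ∅ := by
  obtain ⟨v, hv⟩ := hV
  exact Set.Nonempty.ne_empty ⟨pt v, subset_convexHull ℝ _ ⟨v, hv, rfl⟩⟩

lemma sxc_gt {d : ℕ} {V : Finset (Fin d → Bool)} (hV : V.Nonempty) {k : ℕ}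
    (h : ¬ HasSdpExt (PV V) k) : k < sxc (PV V) := by
  unfold sxc
  rw [if_neg]
  · obtain ⟨l, hl⟩ := lin_exists V
    have hmem : HasSdpExt (PV V) (sInf {k | HasSdpExt (PV V) k}) :=
      Nat.sInf_mem (s := {k | HasSdpExt (PV V) k}) ⟨l, lin_to_sdp hl⟩
    by_contra hlt
    exact h (sdp_mono (not_lt.1 hlt) hmem)
  · rintro (h0 | ⟨p, hp⟩)
    · exact PV_nonempty hV h0
    · exact h (hp ▸ sdp_point p k)

lemma xc_gt {d : ℕ} {V : Finset (Fin d → Bool)} (hV : V.Nonempty) {k : ℕ}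
    (h : ¬ HasLinExt (PV V) k) : k < xc (PV V) := by
  unfold xc
  rw [if_neg]
  · obtain ⟨l, hl⟩ := lin_exists V
    have hmem : HasLinExt (PV V) (sInf {k | HasLinExt (PV V) k}) :=
      Nat.sInf_mem (s := {k | HasLinExt (PV V) k}) ⟨l, hl⟩
    by_contra hlt
    exact h (lin_mono (not_lt.1 hlt) hmem)
  · rintro (h0 | ⟨p, hp⟩)
    · exact PV_nonempty hV h0
    · exact h (hp ▸ lin_point p k)

lemma sdp_zero {d : ℕ} (hd : 1 ≤ d) :
    ∃ V : Finset (Fin d → Bool), V.Nonempty ∧ ¬ HasSdpExt (PV V) 0 := by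
  refine ⟨Finset.univ, Finset.univ_nonempty, ?_⟩
  rintro ⟨n, φ, M, -, hP⟩
  have hall : ∀ y, φ y ∈ PV (Finset.univ : Finset (Fin d → Bool)) := by
    intro y
    rw [hP]
    refine ⟨y, ?_, rfl⟩
    have : M y = 0 := Subsingleton.elim _ _
    rw [Set.mem_ofPred_eq, this]
    exact PosSemidef.zero
  have hex : ∀ v : Fin d → Bool, ∃ y, φ y = pt v := by
    intro v
    have : pt v ∈ PV (Finset.univ : Finset (Fin d → Bool)) :=
      subset_convexHull ℝ _ ⟨v, by simp, rfl⟩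
    rw [hP] at this
    obtain ⟨y, _, hy⟩ := this
    exact ⟨y, hy⟩
  obtain ⟨y0, h0⟩ := hex fun _ => false
  obtain ⟨y1, h1⟩ := hex fun _ => true
  have h := hall ((-1 : ℝ) • y0 + (2 : ℝ) • y1)
  rw [aff_two φ _ _ _ _ (by norm_num), h0, h1] at h
  have h2 := (ham_PV _ (fun _ => false) _ h).1
  rw [ham_two _ _ _ _ _ (by norm_num), ham_self] at h2
  have h3 : ham (fun _ => false) (pt (fun _ : Fin d => true)) = d := by
    simp [ham, pt, cb]
  rw [h3] at h2
  have : (1 : ℝ) ≤ d := by exact_mod_cast hd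
  linarith

lemma sdp_main {d k : ℕ} (hd : 1 ≤ d) (h : 1 ≤ k → 81 * d ^ 2 * (k * k) ^ 2 ≤ 2 ^ d) :
    ∃ V : Finset (Fin d → Bool), V.Nonempty ∧ ¬ HasSdpExt (PV V) k := by
  rcases Nat.eq_zero_or_pos k with rfl | hk
  · exact sdp_zero hd
  · obtain ⟨V, hV, hG⟩ := core (d := d) (T := Fin k × Fin k)
      {z | (Matrix.of fun i j => z (i, j)).PosSemidef} hd
      (by rw [Fintype.card_prod, Fintype.card_fin]; exact Nat.mul_pos hk hk) (by simpa using h hk)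
    exact ⟨V, hV, fun hh => hG (good_sdp hd hk hV hh)⟩

lemma lin_main {d k : ℕ} (hd : 1 ≤ d) (h : 1 ≤ k → 81 * d ^ 2 * k ^ 2 ≤ 2 ^ d) :
    ∃ V : Finset (Fin d → Bool), V.Nonempty ∧ ¬ HasLinExt (PV V) k := by
  rcases Nat.eq_zero_or_pos k with rfl | hk
  · obtain ⟨V, hV, hh⟩ := sdp_zero hd
    exact ⟨V, hV, fun h' => hh (lin_to_sdp h')⟩
  · obtain ⟨V, hV, hG⟩ := core (d := d) (T := Fin k) {z | ∀ i, 0 ≤ z i} hd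
      (by rw [Fintype.card_fin]; exact hk) (by simpa using h hk)
    exact ⟨V, hV, fun hh => hG (good_lin hd hk hV hh)⟩

end Helpers

theorem statement14 (d : ℕ) (hd : 3 ≤ d) :
    (∃ P : Set (EuclideanSpace ℝ (Fin d)), IsZeroOnePolytope P ∧
        (2 : ℝ) ^ ((d : ℝ) / 4) / (3 * Real.sqrt d) < (sxc P : ℝ)) ∧
    (∃ P' : Set (EuclideanSpace ℝ (Fin d)), IsZeroOnePolytope P' ∧
        (2 : ℝ) ^ ((d : ℝ) / 2) / (9 * d) < (xc P' : ℝ)) := by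
  have hd1 : 1 ≤ d := by omega
  have hd0 : (0 : ℝ) < d := by exact_mod_cast hd1
  have hsd : 0 < Real.sqrt d := Real.sqrt_pos.2 hd0
  constructor
  · set X : ℝ := (2 : ℝ) ^ ((d : ℝ) / 4) / (3 * Real.sqrt d) with hX
    have hX0 : 0 ≤ X := by positivity
    have hX4 : 81 * (d : ℝ) ^ 2 * X ^ 4 = 2 ^ d := by
      have h1 : ((2 : ℝ) ^ ((d : ℝ) / 4)) ^ 4 = 2 ^ d := by
        rw [← Real.rpow_natCast, ← Real.rpow_mul (by norm_num), ← Real.rpow_natCast]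
        congr 1
        push_cast
        ring
      have h2 : (Real.sqrt d) ^ 4 = (d : ℝ) ^ 2 := by
        rw [show (4 : ℕ) = 2 * 2 from rfl, pow_mul, Real.sq_sqrt hd0.le]
      rw [hX, div_pow, mul_pow, h1, h2]
      field_simp
      norm_num
    have hfl := Nat.floor_le hX0
    obtain ⟨V, hV, hno⟩ := sdp_main (k := ⌊X⌋₊) hd1 (fun _ => by
      have : (81 * d ^ 2 * (⌊X⌋₊ * ⌊X⌋₊) ^ 2 : ℝ) ≤ 2 ^ d := by
        rw [← hX4]
        have : ((⌊X⌋₊ : ℝ) * ⌊X⌋₊) ^ 2 = (⌊X⌋₊ : ℝ) ^ 4 := by ring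
        rw [this]
        gcongr
      exact_mod_cast this)
    refine ⟨PV V, PV_zo V, (Nat.lt_floor_add_one X).trans_le ?_⟩
    exact_mod_cast sxc_gt hV hno
  · set X : ℝ := (2 : ℝ) ^ ((d : ℝ) / 2) / (9 * d) with hX
    have hX0 : 0 ≤ X := by positivity
    have hX2 : 81 * (d : ℝ) ^ 2 * X ^ 2 = 2 ^ d := by
      have h1 : ((2 : ℝ) ^ ((d : ℝ) / 2)) ^ 2 = 2 ^ d := by
        rw [← Real.rpow_natCast, ← Real.rpow_mul (by norm_num), ← Real.rpow_natCast]
        congr 1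
        push_cast
        ring
      rw [hX, div_pow, mul_pow, h1]
      field_simp
      norm_num
    have hfl := Nat.floor_le hX0
    obtain ⟨V, hV, hno⟩ := lin_main (k := ⌊X⌋₊) hd1 (fun _ => by
      have : (81 * d ^ 2 * ⌊X⌋₊ ^ 2 : ℝ) ≤ 2 ^ d := by
        rw [← hX2]
        gcongr
      exact_mod_cast this)
    refine ⟨PV V, PV_zo V, (Nat.lt_floor_add_one X).trans_le ?_⟩
    exact_mod_cast xc_gt hV hno
end
end

section
/- Let n ∈ ℕ with n ≥ 2. Among the polygons with n vertices, all of whose vertices lie in the integer grid [n²]×[n⁴] := {1,…,n²}×{1,…,n⁴}, there exists one, P, with sxc(P) ≥ n^{1/4}/4. -/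
open Metric Set

noncomputable section

/-- Bounded-coordinate generating subfamily (maximal volume). -/
lemma exists_bounded_gen {ι J : Type*} [Finite ι] [Nonempty ι] [Fintype J]
    (w : ι → (J → ℝ)) :
    ∃ t : J → ι, ∀ i, ∃ l : J → ℝ, (∀ a, |l a| ≤ 1) ∧ w i = ∑ a, l a • w (t a) := by
  classical
  have hsub : ∀ i, w i ∈ Submodule.span ℝ (Set.range w) :=
    fun i => Submodule.subset_span ⟨i, rfl⟩
  set E := Submodule.span ℝ (Set.range w) with hE
  set r := Module.finrank ℝ E with hr
  obtain ⟨f, hf, hfs, hfli⟩ := Submodule.exists_fun_fin_finrank_span_eq ℝ (Set.range w)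
  choose t0 ht0 using hf
  let w' : ι → E := fun i => ⟨w i, hsub i⟩
  let b : Module.Basis (Fin r) ℝ E := Module.finBasis ℝ E
  let g : (Fin r → ι) → ℝ := fun t => |b.det (w' ∘ t)|
  obtain ⟨t, ht⟩ := Finite.exists_max g
  have h0 : 0 < g t0 := by
    have hli : LinearIndependent ℝ (w' ∘ t0) := by
      apply LinearIndependent.of_comp E.subtype
      have : (E.subtype ∘ w' ∘ t0) = f := by
        funext a; simp [w', ht0]
      rw [this]; exact hfli
    have hsp : Submodule.span ℝ (Set.range (w' ∘ t0)) = ⊤ := 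
      hli.span_eq_top_of_card_eq_finrank' (Fintype.card_fin _)
    exact abs_pos.2 ((b.is_basis_iff_det).1 ⟨hli, hsp⟩).ne_zero
  have hpos : 0 < g t := h0.trans_le (ht t0)
  have hb := (b.is_basis_iff_det (v := w' ∘ t)).2 (isUnit_iff_ne_zero.2 (abs_pos.1 hpos))
  let B := Module.Basis.mk hb.1 hb.2.ge
  have hrJ : r ≤ Fintype.card J := by
    simpa using Submodule.finrank_le E
  obtain ⟨e⟩ : Nonempty (Fin r ↪ J) := Function.Embedding.nonempty_of_card_le (by simpa using hrJ)
  refine ⟨fun a => if h : ∃ x, e x = a then t h.choose else Classical.arbitrary ι, fun i => ?_⟩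
  refine ⟨Function.extend e (fun x => B.repr (w' i) x) 0, ?_, ?_⟩
  · intro a
    by_cases h : ∃ x, e x = a
    · obtain ⟨x, rfl⟩ := h
      rw [e.injective.extend_apply]
      have h1 := Module.Basis.det_smul_mk_coord_eq_det_update b hb.1 hb.2.ge x
      have h2 := congrArg (fun F => F (w' i)) h1
      have h3 : b.det (w' ∘ t) * B.repr (w' i) x = b.det (w' ∘ Function.update t x i) := by
        rw [Function.comp_update]
        exact h2
      have h4 : g t * |B.repr (w' i) x| ≤ g t := by
        have := ht (Function.update t x i)
        simp only [g] at this ⊢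
        rw [← h3, abs_mul] at this
        exact this
      nlinarith [abs_nonneg (B.repr (w' i) x)]
    · rw [Function.extend_apply' _ _ _ h]; simp
  · have h5 : w i = ∑ x, B.repr (w' i) x • w (t x) := by
      have := congrArg E.subtype (B.sum_repr (w' i))
      simpa [B, w'] using this.symm
    rw [h5]
    refine Finset.sum_of_injOn e e.injective.injOn (by simp) ?_ ?_
    · intro a _ ha
      rw [Function.extend_apply']
      · simp
      · rintro ⟨x, hx⟩; exact ha ⟨x, by simp, hx⟩
    · intro x _
      have h : ∃ y, e y = e x := ⟨x, rfl⟩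
      beta_reduce
      rw [e.injective.extend_apply, dif_pos h, e.injective h.choose_spec]

/-- Perturbation of a diagonal projection. -/
lemma posSemidef_perturb {k : ℕ} (p : Fin k → ℝ) (hp : ∀ a, p a = 0 ∨ p a = 1)
    (Z : Matrix (Fin k) (Fin k) ℝ) (hZ : Z.IsHermitian) (δ : ℝ) 
    (hb : ∀ a b, |Z a b| ≤ δ * (p a * p b)) :
    (Z + (k * δ) • Matrix.diagonal p).PosSemidef := by
  refine Matrix.PosSemidef.of_dotProduct_mulVec_nonneg ?_ ?_
  · refine hZ.add ?_
    rw [← Matrix.diagonal_smul]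
    exact Matrix.isHermitian_diagonal _
  intro x
  have e1 : star x ⬝ᵥ ((Z + (k * δ) • Matrix.diagonal p).mulVec x)
      = ∑ a, ∑ b, (x a * Z a b * x b + δ * (p a * x a ^ 2 + p b * x b ^ 2) / 2) := by
    have : ∑ a : Fin k, ∑ b : Fin k, (δ * (p a * x a ^ 2 + p b * x b ^ 2) / 2) = 
        k * δ * ∑ a, p a * x a ^ 2 := by
      simp only [mul_add, add_div, Finset.sum_add_distrib, Finset.sum_const, Finset.card_univ,
        Fintype.card_fin, nsmul_eq_mul]
      rw [← Finset.mul_sum, ← Finset.sum_div, ← Finset.mul_sum]; ring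
    simp only [Finset.sum_add_distrib] at this ⊢
    rw [this, Matrix.add_mulVec, dotProduct_add, Matrix.smul_mulVec, dotProduct_smul]
    congr 1
    · simp only [dotProduct, Matrix.mulVec, Finset.mul_sum]
      simp [mul_assoc]
    · simp only [dotProduct, Matrix.mulVec_diagonal, smul_eq_mul]
      congr 1
      apply Finset.sum_congr rfl; intro a _; simp; ring
  rw [e1]
  refine Finset.sum_nonneg fun a _ => Finset.sum_nonneg fun b _ => ?_
  have h := abs_le.1 (hb a b)
  rcases hp a with ha | ha <;> rcases hp b with hb' | hb' <;> simp only [ha, hb'] at h ⊢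
  · have : Z a b = 0 := by linarith [h.1, h.2]
    simp [this]
  · have hz : Z a b = 0 := by linarith [h.1, h.2]
    have hd : 0 ≤ δ := by
      have := (abs_nonneg _).trans (hb b b); simpa [hb'] using this
    rw [hz]; nlinarith [mul_nonneg hd (sq_nonneg (x b))]
  · have hz : Z a b = 0 := by linarith [h.1, h.2]
    have hd : 0 ≤ δ := by
      have := (abs_nonneg _).trans (hb a a); simpa [ha] using this
    rw [hz]; nlinarith [mul_nonneg hd (sq_nonneg (x a))]
  · nlinarith [mul_nonneg (by linarith [h.1] : 0 ≤ δ + Z a b) (sq_nonneg (x a + x b)),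
      mul_nonneg (by linarith [h.2] : 0 ≤ δ - Z a b) (sq_nonneg (x a - x b))]

/-- Entry bounds for PSD matrices dominated by a diagonal projection. -/
lemma entry_bound {k : ℕ} (p : Fin k → ℝ) (hp : ∀ a, p a = 0 ∨ p a = 1)
    (Y : Matrix (Fin k) (Fin k) ℝ) (hY : Y.PosSemidef) 
    (hY' : (Matrix.diagonal p - Y).PosSemidef) (a b : Fin k) :
    |Y a b| ≤ p a * p b := by
  have hd : ∀ a, 0 ≤ Y a a ∧ Y a a ≤ p a := fun a => by
    have h1 := hY.diag_nonneg (i := a)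
    have h2 := hY'.diag_nonneg (i := a)
    simp at h2
    exact ⟨h1, h2⟩
  have hdet := (hY.submatrix ![a, b]).det_nonneg
  rw [Matrix.det_fin_two] at hdet
  simp at hdet
  have hs : Y b a = Y a b := by simpa using hY.1.apply a b
  rw [hs] at hdet
  obtain ⟨h1, h2⟩ := hd a
  obtain ⟨h3, h4⟩ := hd b
  have h5 : Y a b ^ 2 ≤ (p a * p b) ^ 2 := by
    have : (p a * p b) ^ 2 = p a * p b := by
      rcases hp a with ha | ha <;> rcases hp b with hb | hb <;> simp [ha, hb]
    rw [this]
    have := mul_le_mul h2 h4 h3 (h1.trans h2)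
    nlinarith
  exact abs_le_of_sq_le_sq h5 (mul_nonneg (h1.trans h2) (h3.trans h4))

/-- Certificate-style consequence of an SDP extension. -/
def SdpCert (S : Finset ℕ) (k : ℕ) : Prop :=
  ∃ X : ℕ → Matrix (Fin k) (Fin k) ℝ, (∀ i ∈ S, (X i).PosSemidef) ∧
    ∀ c : ℕ → ℝ, ∑ i ∈ S, c i = 1 → (∑ i ∈ S, c i • X i).PosSemidef →
      ∀ (j : ℕ) (m : ℝ), (∀ i ∈ S, m ≤ ((i : ℝ) - j) ^ 2) →
        m ≤ ∑ i ∈ S, c i * ((i : ℝ) - j) ^ 2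

/-- Points on the parabola. -/
def parPt (i : ℕ) : EuclideanSpace ℝ (Fin 2) :=
  (EuclideanSpace.equiv (Fin 2) ℝ).symm ![(i : ℝ), (i : ℝ) ^ 2]

lemma parPt_zero (i : ℕ) : parPt i 0 = i := rfl
lemma parPt_one (i : ℕ) : parPt i 1 = (i : ℝ) ^ 2 := rfl

lemma parPt_inj : Function.Injective parPt := by
  intro i j h
  have := congrArg (fun v : EuclideanSpace ℝ (Fin 2) => v 0) h
  simp only [parPt_zero] at this
  exact_mod_cast this

lemma halfspace (T : Set ℕ) (j : ℕ) (m : ℝ) (h : ∀ i ∈ T, m ≤ ((i : ℝ) - j) ^ 2)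
    (p : EuclideanSpace ℝ (Fin 2)) (hp : p ∈ convexHull ℝ (parPt '' T)) :
    m ≤ p 1 - 2 * j * p 0 + (j : ℝ) ^ 2 := by
  have hc : Convex ℝ {p : EuclideanSpace ℝ (Fin 2) | m ≤ p 1 - 2 * j * p 0 + (j : ℝ) ^ 2} := by
    intro x hx y hy a b ha hb hab
    simp only [Set.mem_ofPred_eq, PiLp.add_apply, PiLp.smul_apply, smul_eq_mul] at *
    have h1 := mul_le_mul_of_nonneg_left hx ha
    have h2 := mul_le_mul_of_nonneg_left hy hb
    have : b = 1 - a := by linarith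
    subst this
    nlinarith
  refine convexHull_min ?_ hc hp
  rintro _ ⟨i, hi, rfl⟩
  have := h i hi
  simp only [Set.mem_ofPred_eq, parPt_zero, parPt_one]
  nlinarith

lemma affine_comb_s16 {E F : Type*} [AddCommGroup E] [Module ℝ E] [AddCommGroup F] [Module ℝ F]
    (M : E →ᵃ[ℝ] F) (S : Finset ℕ) (c : ℕ → ℝ) (hc : ∑ i ∈ S, c i = 1) (x : ℕ → E) :
    M (∑ i ∈ S, c i • x i) = ∑ i ∈ S, c i • M (x i) := by
  have h : ∀ y, M y = M.linear y + M 0 := fun y => congrFun M.decomp y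
  rw [h]
  simp only [fun i => h (x i), smul_add, Finset.sum_add_distrib, ← Finset.sum_smul, hc, map_sum,
    map_smul, one_smul]

lemma cert_of_ext (S : Finset ℕ) (k : ℕ) (h : HasSdpExt (convexHull ℝ (parPt '' (S : Set ℕ))) k) :
    SdpCert S k := by
  obtain ⟨n, φ, M, hs, hP⟩ := h
  have hx : ∀ i : ℕ, ∃ x, i ∈ S → (M x).PosSemidef ∧ φ x = parPt i := by
    intro i
    by_cases hi : i ∈ S
    · have : parPt i ∈ convexHull ℝ (parPt '' (S : Set ℕ)) := subset_convexHull _ _ ⟨i, hi, rfl⟩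
      rw [hP] at this
      obtain ⟨x, hx, hx'⟩ := this
      exact ⟨x, fun _ => ⟨hx, hx'⟩⟩
    · exact ⟨0, fun h => absurd h hi⟩
  choose x hx using hx
  refine ⟨fun i => M (x i), fun i hi => (hx i hi).1, ?_⟩
  intro c hc hpsd j m hm
  rw [← affine_comb_s16 M S c hc] at hpsd
  have hmem : φ (∑ i ∈ S, c i • x i) ∈ convexHull ℝ (parPt '' (S : Set ℕ)) := by
    rw [hP]; exact ⟨_, hpsd, rfl⟩
  rw [affine_comb_s16 φ S c hc] at hmem
  have hh := halfspace S j m hm _ hmem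
  have e : ∑ i ∈ S, c i • φ (x i) = ∑ i ∈ S, c i • parPt i :=
    Finset.sum_congr rfl fun i hi => by rw [(hx i hi).2]
  rw [e] at hh
  have e0 : (∑ i ∈ S, c i • parPt i) 0 = ∑ i ∈ S, c i * (i : ℝ) := by
    simp [WithLp.ofLp_sum, Finset.sum_apply, parPt_zero]
  have e1 : (∑ i ∈ S, c i • parPt i) 1 = ∑ i ∈ S, c i * (i : ℝ) ^ 2 := by
    simp [WithLp.ofLp_sum, Finset.sum_apply, parPt_one]
  rw [e0, e1] at hh
  have e2 : ∑ i ∈ S, c i * ((i : ℝ) - j) ^ 2 = ∑ i ∈ S, c i * (i : ℝ) ^ 2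
      - 2 * j * ∑ i ∈ S, c i * (i : ℝ) + (j : ℝ) ^ 2 * ∑ i ∈ S, c i := by
    simp only [Finset.mul_sum, ← Finset.sum_sub_distrib, ← Finset.sum_add_distrib]
    exact Finset.sum_congr rfl fun i _ => by ring
  rw [e2, hc]; linarith

lemma cert_mono (S : Finset ℕ) {k K : ℕ} (hk : k ≤ K) (h : SdpCert S k) : SdpCert S K := by
  obtain ⟨X, hX, hc⟩ := h
  let E : Matrix (Fin K) (Fin k) ℝ := (1 : Matrix (Fin K) (Fin K) ℝ).submatrix id (Fin.castLE hk)
  have hE : E.conjTranspose * E = 1 := by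
    ext a b
    simp [E, Matrix.mul_apply, Matrix.one_apply]
  refine ⟨fun i => E * X i * E.conjTranspose, fun i hi => (hX i hi).mul_mul_conjTranspose_same E, ?_⟩
  intro c h1 h2
  refine hc c h1 ?_
  have h3 := h2.conjTranspose_mul_mul_same E
  have h4 : E.conjTranspose * (∑ i ∈ S, c i • (E * X i * E.conjTranspose)) * E
      = ∑ i ∈ S, c i • X i := by
    rw [Matrix.mul_sum, Matrix.sum_mul]
    refine Finset.sum_congr rfl fun i _ => ?_
    rw [Matrix.mul_smul, Matrix.smul_mul]
    congr 1
    calc _ = (E.conjTranspose * E) * X i * (E.conjTranspose * E) := by simp only [Matrix.mul_assoc]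
      _ = X i := by rw [hE]; simp
  rwa [h4] at h3

lemma cert_pos (S : Finset ℕ) (hS : 2 ≤ S.card) (h : SdpCert S 0) : False := by
  obtain ⟨X, hX, hc⟩ := h
  obtain ⟨i, hi, j, hj, hij⟩ := Finset.one_lt_card.1 hS
  have key := hc (fun a => if a = i then 2 else if a = j then -1 else 0) ?_ ?_ i 0
    (fun _ _ => sq_nonneg _)
  · have e : ∑ a ∈ S, (if a = i then (2 : ℝ) else if a = j then -1 else 0) * ((a : ℝ) - i) ^ 2
        = - ((j : ℝ) - i) ^ 2 := by
      rw [Finset.sum_eq_single j]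
      · simp [Ne.symm hij]
      · intro b _ hb
        by_cases hbi : b = i <;> simp [hbi, hb]
      · intro h; exact absurd hj h
    rw [e] at key
    have : (j : ℝ) - i ≠ 0 := sub_ne_zero.2 (by exact_mod_cast (Ne.symm hij))
    have := sq_pos_of_ne_zero this
    linarith
  · have e : ∀ a, (if a = i then (2 : ℝ) else if a = j then -1 else 0) =
        (if a = i then 2 else 0) + (if a = j then -1 else 0) := by
      intro a
      by_cases h1 : a = i
      · simp [h1, hij]
      · simp [h1]
    simp only [e, Finset.sum_add_distrib, Finset.sum_ite_eq', hi, hj]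
    norm_num
  · refine Matrix.PosSemidef.of_dotProduct_mulVec_nonneg ?_ ?_
    · ext a; exact a.elim0
    · intro x; simp

/-- Normalised certificates. -/
lemma cert_norm (S : Finset ℕ) (k : ℕ) (h : SdpCert S k) :
    ∃ (p : Fin k → Bool) (Y : ℕ → Matrix (Fin k) (Fin k) ℝ), (∀ i ∈ S, (Y i).PosSemidef) ∧
    (∑ i ∈ S, Y i = Matrix.diagonal fun a => if p a then (1 : ℝ) else 0) ∧
    ∀ c : ℕ → ℝ, 0 < ∑ i ∈ S, c i → (∑ i ∈ S, c i • Y i).PosSemidef →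
      ∀ (j : ℕ), j ∉ S → ∑ i ∈ S, c i ≤ ∑ i ∈ S, c i * ((i : ℝ) - j) ^ 2 := by
  classical
  obtain ⟨X, hX, hc⟩ := h
  have hA := Matrix.posSemidef_sum S hX
  set A := ∑ i ∈ S, X i with hAdef
  have hev := hA.eigenvalues_nonneg
  set d := hA.1.eigenvalues with hd
  let U₀ : Matrix (Fin k) (Fin k) ℝ := hA.1.eigenvectorUnitary
  have hspec : star U₀ * A * U₀ = Matrix.diagonal d := by
    have := hA.1.conjStarAlgAut_star_eigenvectorUnitary
    rw [Unitary.conjStarAlgAut_star_apply] at this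
    exact this
  let s : Fin k → ℝ := fun a => if d a = 0 then 1 else (Real.sqrt (d a))⁻¹
  have hs : ∀ a, s a ≠ 0 := by
    intro a
    by_cases h : d a = 0
    · simp [s, h]
    · have : 0 < d a := lt_of_le_of_ne (hev a) (Ne.symm h)
      simp only [s, h, if_false]
      exact inv_ne_zero (Real.sqrt_pos.2 this).ne'
  let U := U₀ * Matrix.diagonal s
  have hU : IsUnit U := by
    refine IsUnit.mul ?_ ?_
    · exact Unitary.isUnit_coe
    · rw [Matrix.isUnit_iff_isUnit_det, Matrix.det_diagonal]
      exact isUnit_iff_ne_zero.2 (Finset.prod_ne_zero_iff.2 fun a _ => hs a)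
  have hsum : ∀ c : ℕ → ℝ, ∑ i ∈ S, c i • (star U * X i * U) = star U * (∑ i ∈ S, c i • X i) * U := by
    intro c
    rw [Finset.mul_sum, Finset.sum_mul]
    exact Finset.sum_congr rfl fun i _ => by rw [Matrix.mul_smul, Matrix.smul_mul]
  refine ⟨fun a => decide (d a ≠ 0), fun i => star U * X i * U, fun i hi => ?_, ?_, ?_⟩
  · exact (Matrix.IsUnit.posSemidef_star_left_conjugate_iff hU).2 (hX i hi)
  · have h1 := hsum (fun _ => 1)
    simp only [one_smul] at h1
    rw [h1, ← hAdef]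
    have h2 : star U * A * U = Matrix.diagonal s * (star U₀ * A * U₀) * Matrix.diagonal s := by
      simp only [U, star_mul, Matrix.mul_assoc]
      congr 1
      simp [Matrix.star_eq_conjTranspose]
    rw [h2, hspec, Matrix.diagonal_mul_diagonal, Matrix.diagonal_mul_diagonal]
    congr 1
    funext a
    by_cases h : d a = 0
    · simp [h]
    · have : 0 < d a := lt_of_le_of_ne (hev a) (Ne.symm h)
      have h3 := (Real.sqrt_pos.2 this).ne'
      have h4 := Real.mul_self_sqrt this.le
      simp only [s, h, if_false, ne_eq, not_false_eq_true, decide_true, if_true]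
      field_simp
      nlinarith
  · intro c hpos hpsd j hj
    rw [hsum, Matrix.IsUnit.posSemidef_star_left_conjugate_iff hU] at hpsd
    set H := ∑ i ∈ S, c i with hH
    have := hc (fun i => H⁻¹ * c i) ?_ ?_ j 1 ?_
    · simp only [mul_assoc, ← Finset.mul_sum] at this
      rw [inv_mul_eq_div, le_div_iff₀ hpos] at this
      linarith
    · rw [← Finset.mul_sum, ← hH, inv_mul_cancel₀ hpos.ne']
    · simp only [mul_smul, ← Finset.smul_sum]
      exact hpsd.smul (inv_nonneg.2 hpos.le)
    · intro i hi
      have hne : i ≠ j := fun e => hj (e ▸ hi)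
      have : (1 : ℤ) ≤ ((i : ℤ) - j) ^ 2 := by
        have : (i : ℤ) - j ≠ 0 := by omega
        have := sq_pos_of_ne_zero this
        omega
      exact_mod_cast this

/-- Index type for the generating subfamily. -/
abbrev GenIdx (k : ℕ) : Type := Fin 3 ⊕ (Fin k × Fin k)

/-- Normalised certificate together with a bounded generating subfamily. -/
def NData (S : Finset ℕ) (k : ℕ) (p : Fin k → Bool) (Y : ℕ → Matrix (Fin k) (Fin k) ℝ)
    (t : GenIdx k → ℕ) : Prop :=
  (∀ i ∈ S, (Y i).PosSemidef) ∧
    (∑ i ∈ S, Y i = Matrix.diagonal fun a => if p a then (1 : ℝ) else 0) ∧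
    (∀ c : ℕ → ℝ, 0 < ∑ i ∈ S, c i → (∑ i ∈ S, c i • Y i).PosSemidef →
      ∀ (j : ℕ), j ∉ S → ∑ i ∈ S, c i ≤ ∑ i ∈ S, c i * ((i : ℝ) - j) ^ 2) ∧
    (∀ a, t a ∈ S) ∧
    ∀ i ∈ S, ∃ l : GenIdx k → ℝ, (∀ a, |l a| ≤ 1) ∧ ∑ a, l a = 1 ∧
      ∑ a, l a * (t a : ℝ) = i ∧ ∑ a, l a * (t a : ℝ) ^ 2 = (i : ℝ) ^ 2 ∧
      ∑ a, l a • Y (t a) = Y i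

lemma exists_ndata (S : Finset ℕ) (hS : S.Nonempty) (k : ℕ) (h : SdpCert S k) :
    ∃ p Y t, NData S k p Y t := by
  obtain ⟨p, Y, h1, h2, h3⟩ := cert_norm S k h
  have : Nonempty S := hS.to_subtype
  let w : S → (GenIdx k → ℝ) := fun i =>
    Sum.elim ![1, ((i : ℕ) : ℝ), ((i : ℕ) : ℝ) ^ 2] (fun q => Y i q.1 q.2)
  obtain ⟨t, ht⟩ := exists_bounded_gen w
  refine ⟨p, Y, fun a => t a, h1, h2, h3, fun a => (t a).2, ?_⟩
  intro i hi
  obtain ⟨l, hl, hw⟩ := ht ⟨i, hi⟩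
  have hw' : ∀ q, w ⟨i, hi⟩ q = ∑ a, l a * w (t a) q := by
    intro q
    rw [hw]
    simp [Finset.sum_apply]
  refine ⟨l, hl, ?_, ?_, ?_, ?_⟩
  · have := hw' (Sum.inl 0)
    simpa [w] using this.symm
  · have := hw' (Sum.inl 1)
    simpa [w] using this.symm
  · have := hw' (Sum.inl 2)
    simpa [w] using this.symm
  · ext x y
    have := hw' (Sum.inr (x, y))
    simpa [w, Matrix.sum_apply] using this.symm

lemma ndata_entry {S : Finset ℕ} {k : ℕ} {p Y t} (h : NData S k p Y t) (i : ℕ) (hi : i ∈ S)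
    (x y : Fin k) : |Y i x y| ≤ (if p x then (1 : ℝ) else 0) * (if p y then (1 : ℝ) else 0) := by
  refine entry_bound (fun a => if p a then (1 : ℝ) else 0) ?_ (Y i) (h.1 i hi) ?_ x y
  · intro a; cases p a <;> simp
  · rw [← h.2.1, ← Finset.add_sum_erase S Y hi, add_sub_cancel_left]
    exact Matrix.posSemidef_sum _ fun j hj => h.1 j (Finset.mem_of_mem_erase hj)

lemma sum_coef {V : Type*} [AddCommGroup V] [Module ℝ V] {J : Type*} [Fintype J] (S : Finset ℕ)
    (t : J → ℕ) (ht : ∀ a, t a ∈ S) (l : J → ℝ) (η : ℝ) (F : ℕ → V) :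
    ∑ i ∈ S, ((∑ a, if t a = i then l a else 0) + η) • F i
      = ∑ a, l a • F (t a) + η • ∑ i ∈ S, F i := by
  simp only [add_smul, Finset.sum_add_distrib, Finset.sum_smul, Finset.smul_sum]
  congr 1
  rw [Finset.sum_comm]
  refine Finset.sum_congr rfl fun a _ => ?_
  rw [Finset.sum_eq_single (t a)]
  · simp
  · intro b _ hb; simp [Ne.symm hb]
  · intro h; exact absurd (ht a) h

lemma core_s16 {S S' : Finset ℕ} {k : ℕ} {p Y Y' t} (h : NData S k p Y t) (h' : NData S' k p Y' t)
    (ε : ℝ) (hε : 0 ≤ ε) (hclose : ∀ a x y, |Y (t a) x y - Y' (t a) x y| ≤ ε) (N : ℕ)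
    (hN : ∀ i ∈ S, i ≤ N) (hN' : ∀ i ∈ S', i ≤ N)
    (hsmall : (k * (Fintype.card (GenIdx k) * ε)) * (S.card * (N : ℝ) ^ 2) < 1) : S' ⊆ S := by
  intro j hj
  by_contra hjS
  obtain ⟨l, hl, l0, l1, l2, lY⟩ := h'.2.2.2.2 j hj
  set δ : ℝ := Fintype.card (GenIdx k) * ε with hδ
  have hδ0 : 0 ≤ δ := by positivity
  set η : ℝ := k * δ with hη
  have hη0 : 0 ≤ η := by positivity
  let c : ℕ → ℝ := fun i => (∑ a, if t a = i then l a else 0) + η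
  let P : Fin k → ℝ := fun a => if p a then (1 : ℝ) else 0
  have hP : ∀ a, P a = 0 ∨ P a = 1 := by intro a; simp only [P]; cases p a <;> simp
  have ht := h.2.2.2.1
  have ht' := h'.2.2.2.1
  have hc0 : ∑ i ∈ S, c i = 1 + η * S.card := by
    have := sum_coef S t ht l η (fun _ => (1 : ℝ))
    simp only [smul_eq_mul, mul_one, l0, Finset.sum_const, nsmul_eq_mul] at this
    exact this
  have hc2 : ∑ i ∈ S, c i * ((i : ℝ) - j) ^ 2 = η * ∑ i ∈ S, ((i : ℝ) - j) ^ 2 := by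
    have := sum_coef S t ht l η (fun i => ((i : ℝ) - j) ^ 2)
    simp only [smul_eq_mul] at this
    rw [this]
    have e : ∑ a, l a * ((t a : ℝ) - j) ^ 2 = ∑ a, l a * (t a : ℝ) ^ 2
        - 2 * j * ∑ a, l a * (t a : ℝ) + (j : ℝ) ^ 2 * ∑ a, l a := by
      simp only [Finset.mul_sum, ← Finset.sum_sub_distrib, ← Finset.sum_add_distrib]
      exact Finset.sum_congr rfl fun i _ => by ring
    rw [e, l0, l1, l2]; ring
  let Z : Matrix (Fin k) (Fin k) ℝ := ∑ a, l a • (Y (t a) - Y' (t a))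
  have hZ : Z.IsHermitian := by
    refine isSelfAdjoint_sum _ fun a _ => ?_
    have e1 : (Y (t a) - Y' (t a)).IsHermitian := (h.1 _ (ht a)).1.sub (h'.1 _ (ht' a)).1
    exact IsSelfAdjoint.smul (IsSelfAdjoint.all (l a)) e1
  have hZb : ∀ x y, |Z x y| ≤ δ * (P x * P y) := by
    intro x y
    have hterm : ∀ a, |l a * (Y (t a) x y - Y' (t a) x y)| ≤ ε * (P x * P y) := by
      intro a
      have b1 := ndata_entry h (t a) (ht a) x y
      have b2 := ndata_entry h' (t a) (ht' a) x y
      have b3 := hclose a x y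
      change _ ≤ P x * P y at b1
      change _ ≤ P x * P y at b2
      have b4 : |Y (t a) x y - Y' (t a) x y| ≤ ε * (P x * P y) := by
        have hPP : P x * P y = 0 ∨ P x * P y = 1 := by
          rcases hP x with e | e <;> rcases hP y with e' | e' <;> simp [e, e']
        rcases hPP with e | e
        · rw [e] at b1 b2 ⊢
          have z1 : Y (t a) x y = 0 := abs_nonpos_iff.1 b1
          have z2 : Y' (t a) x y = 0 := abs_nonpos_iff.1 b2
          simp [z1, z2]
        · rw [e, mul_one]; exact b3
      rw [abs_mul]
      calc _ ≤ 1 * |Y (t a) x y - Y' (t a) x y| :=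
            mul_le_mul_of_nonneg_right (hl a) (abs_nonneg _)
        _ ≤ _ := by rw [one_mul]; exact b4
    have e : Z x y = ∑ a, l a * (Y (t a) x y - Y' (t a) x y) := by
      simp [Z, Matrix.sum_apply]
    rw [e]
    calc _ ≤ ∑ a, |l a * (Y (t a) x y - Y' (t a) x y)| := Finset.abs_sum_le_sum_abs _ _
      _ ≤ ∑ a : GenIdx k, ε * (P x * P y) := Finset.sum_le_sum fun a _ => hterm a
      _ = _ := by rw [Finset.sum_const, nsmul_eq_mul, hδ, Finset.card_univ]; ring
  have hpsd : (∑ i ∈ S, c i • Y i).PosSemidef := by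
    have e := sum_coef S t ht l η Y
    have e2 : ∑ i ∈ S, c i • Y i = Y' j + (Z + (k * δ) • Matrix.diagonal P) := by
      rw [e, h.2.1, ← lY]
      simp only [Z, smul_sub, Finset.sum_sub_distrib]
      rw [← hη]
      abel
    rw [e2]
    exact (h'.1 j hj).add (posSemidef_perturb P hP Z hZ δ hZb)
  have hle := h.2.2.1 c (by rw [hc0]; positivity) hpsd j hjS
  rw [hc0, hc2] at hle
  have hsum : ∑ i ∈ S, ((i : ℝ) - j) ^ 2 ≤ S.card * (N : ℝ) ^ 2 := by
    rw [← nsmul_eq_mul]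
    refine Finset.sum_le_card_nsmul _ _ _ fun i hi => ?_
    have h1 : (i : ℝ) ≤ N := by exact_mod_cast hN i hi
    have h2 : (j : ℝ) ≤ N := by exact_mod_cast hN' j hj
    have h3 : (0 : ℝ) ≤ i := by positivity
    have h4 : (0 : ℝ) ≤ j := by positivity
    exact sq_le_sq' (by linarith) (by linarith)
  have := mul_le_mul_of_nonneg_left hsum hη0
  have : 0 ≤ η * S.card := by positivity
  linarith

lemma exists_ext {m : ℕ} (v : Fin m → EuclideanSpace ℝ (Fin 2)) :
    HasSdpExt (convexHull ℝ (Set.range v)) (m + 2) := by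
  let D : EuclideanSpace ℝ (Fin m) → (Fin (m + 2) → ℝ) := fun x =>
    Fin.cons (∑ i, x i - 1) (Fin.cons (1 - ∑ i, x i) (fun i => x i))
  let L : EuclideanSpace ℝ (Fin m) →ₗ[ℝ] Matrix (Fin (m + 2)) (Fin (m + 2)) ℝ :=
    { toFun := fun x => Matrix.diagonal
        (Fin.cons (∑ i, x i) (Fin.cons (- ∑ i, x i) (fun i => x i)) : Fin (m + 2) → ℝ)
      map_add' := by
        intro x y
        rw [Matrix.diagonal_add]
        congr 1
        funext a
        refine Fin.cases ?_ (fun a => Fin.cases ?_ (fun a => ?_) a) a <;>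
          simp [Finset.sum_add_distrib, add_comm]
      map_smul' := by
        intro r x
        rw [RingHom.id_apply, ← Matrix.diagonal_smul]
        congr 1
        funext a
        refine Fin.cases ?_ (fun a => Fin.cases ?_ (fun a => ?_) a) a <;>
          simp [Finset.mul_sum] }
  let C : Matrix (Fin (m + 2)) (Fin (m + 2)) ℝ := Matrix.diagonal
    (Fin.cons (-1) (Fin.cons 1 (fun _ => 0)) : Fin (m + 2) → ℝ)
  let M : EuclideanSpace ℝ (Fin m) →ᵃ[ℝ] Matrix (Fin (m + 2)) (Fin (m + 2)) ℝ :=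
    L.toAffineMap + AffineMap.const ℝ _ C
  have hM : ∀ x, M x = Matrix.diagonal (D x) := by
    intro x
    have e : M x = L x + C := rfl
    rw [e]
    simp only [L, C, LinearMap.coe_mk, AddHom.coe_mk]
    rw [Matrix.diagonal_add]
    congr 1
    funext a
    refine Fin.cases ?_ (fun a => Fin.cases ?_ (fun a => ?_) a) a <;> simp [D] <;> ring
  let f : EuclideanSpace ℝ (Fin m) →ₗ[ℝ] EuclideanSpace ℝ (Fin 2) :=
    { toFun := fun x => ∑ i, x i • v i
      map_add' := by intro x y; simp [add_smul, Finset.sum_add_distrib]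
      map_smul' := by intro r x; simp [mul_smul, Finset.smul_sum] }
  refine ⟨m, f.toAffineMap, M, fun x => ?_, ?_⟩
  · rw [hM]; exact Matrix.isSymm_diagonal _
  · have hset : ∀ x, (M x).PosSemidef ↔ (∀ i, 0 ≤ x i) ∧ ∑ i, x i = 1 := by
      intro x
      rw [hM, Matrix.posSemidef_diagonal_iff]
      constructor
      · intro h
        refine ⟨fun i => by simpa [D] using h i.succ.succ, ?_⟩
        have h1 := h 0
        have h2 := h (Fin.succ 0)
        simp only [D, Fin.cons_zero, Fin.cons_succ] at h1 h2
        linarith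
      · rintro ⟨h1, h2⟩ a
        refine Fin.cases ?_ (fun a => Fin.cases ?_ (fun a => ?_) a) a <;> simp [D, h1, h2]
    ext q
    constructor
    · intro hq
      refine convexHull_min ?_ ?_ hq
      · rintro _ ⟨i, rfl⟩
        refine ⟨EuclideanSpace.single i 1, (hset _).2 ⟨fun a => ?_, ?_⟩, ?_⟩
        · by_cases h : a = i <;> simp [h]
        · simp
        · change ∑ a, (EuclideanSpace.single i (1 : ℝ) : EuclideanSpace ℝ (Fin m)) a • v a = v i
          simp
      · have hcv : Convex ℝ {x | (M x).PosSemidef} := by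
          intro x hx y hy a b ha hb hab
          obtain ⟨x1, x2⟩ := (hset x).1 hx
          obtain ⟨y1, y2⟩ := (hset y).1 hy
          refine (hset _).2 ⟨fun i => ?_, ?_⟩
          · have := mul_nonneg ha (x1 i)
            have := mul_nonneg hb (y1 i)
            simp only [PiLp.add_apply, PiLp.smul_apply, smul_eq_mul]
            linarith
          · simp only [PiLp.add_apply, PiLp.smul_apply, smul_eq_mul, Finset.sum_add_distrib,
              ← Finset.mul_sum, x2, y2]
            linarith
        exact hcv.linear_image f
    · rintro ⟨x, hx, rfl⟩
      obtain ⟨h1, h2⟩ := (hset x).1 hx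
      exact (convex_convexHull ℝ _).sum_mem (fun i _ => h1 i) h2
        (fun i _ => subset_convexHull _ _ ⟨i, rfl⟩)

lemma exists_cert (S : Finset ℕ) (hS : 2 ≤ S.card) :
    ∃ k, SdpCert S k ∧ k = sxc (convexHull ℝ (parPt '' (S : Set ℕ))) := by
  refine ⟨_, ?_, rfl⟩
  apply cert_of_ext
  have hne : ¬ (convexHull ℝ (parPt '' (S : Set ℕ)) = ∅ ∨
      ∃ p, convexHull ℝ (parPt '' (S : Set ℕ)) = {p}) := by
    obtain ⟨i, hi, j, hj, hij⟩ := Finset.one_lt_card.1 hS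
    have h1 : parPt i ∈ convexHull ℝ (parPt '' (S : Set ℕ)) := subset_convexHull _ _ ⟨i, hi, rfl⟩
    have h2 : parPt j ∈ convexHull ℝ (parPt '' (S : Set ℕ)) := subset_convexHull _ _ ⟨j, hj, rfl⟩
    rintro (h | ⟨p, h⟩)
    · rw [h] at h1; exact h1
    · rw [h, Set.mem_singleton_iff] at h1 h2
      exact hij (parPt_inj (h1.trans h2.symm))
  rw [sxc, if_neg hne]
  have hn : {k | HasSdpExt (convexHull ℝ (parPt '' (S : Set ℕ))) k}.Nonempty := by
    have := exists_ext (fun a : Fin S.card => parPt (S.equivFin.symm a))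
    refine ⟨S.card + 2, ?_⟩
    have e : Set.range (fun a : Fin S.card => parPt (S.equivFin.symm a)) = parPt '' (S : Set ℕ) := by
      ext q
      constructor
      · rintro ⟨a, rfl⟩; exact ⟨_, (S.equivFin.symm a).2, rfl⟩
      · rintro ⟨i, hi, rfl⟩; exact ⟨S.equivFin ⟨i, hi⟩, by simp⟩
    rw [e] at this
    exact this
  exact Nat.sInf_mem hn

/-- The family of vertex index sets. -/
def gSet (n : ℕ) (g : Fin n → Fin n) : Finset ℕ :=
  Finset.univ.image fun i : Fin n => n * (i : ℕ) + (g i : ℕ) + 1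

lemma gSet_aux {n : ℕ} {i j a b : ℕ} (ha : a < n) (hb : b < n) (h : n * i + a + 1 = n * j + b + 1) :
    i = j ∧ a = b := by
  have h' : a + n * i = b + n * j := by omega
  have hn : 0 < n := by omega
  have h1 := congrArg (· / n) h'
  have h2 := congrArg (· % n) h'
  simp only [Nat.add_mul_div_left _ _ hn, Nat.div_eq_of_lt ha, Nat.div_eq_of_lt hb] at h1
  simp only [Nat.add_mul_mod_self_left, Nat.mod_eq_of_lt ha, Nat.mod_eq_of_lt hb] at h2
  omega

lemma gSet_card (n : ℕ) (g : Fin n → Fin n) : (gSet n g).card = n := by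
  rw [gSet, Finset.card_image_of_injective, Finset.card_univ, Fintype.card_fin]
  intro i j h
  exact Fin.ext (gSet_aux (g i).2 (g j).2 h).1

lemma gSet_inj (n : ℕ) : Function.Injective (gSet n) := by
  intro g g' h
  funext i
  have : n * (i : ℕ) + (g i : ℕ) + 1 ∈ gSet n g' := by
    rw [← h]; exact Finset.mem_image.2 ⟨i, Finset.mem_univ _, rfl⟩
  obtain ⟨j, _, hj⟩ := Finset.mem_image.1 this
  obtain ⟨h1, h2⟩ := gSet_aux (g' j).2 (g i).2 hj
  have : j = i := Fin.ext h1
  subst this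
  exact Fin.ext h2.symm

lemma gSet_bound (n : ℕ) (g : Fin n → Fin n) (i : ℕ) (hi : i ∈ gSet n g) : 1 ≤ i ∧ i ≤ n ^ 2 := by
  obtain ⟨j, _, rfl⟩ := Finset.mem_image.1 hi
  have h1 := j.2
  have h2 := (g j).2
  refine ⟨by omega, ?_⟩
  have : n * (j : ℕ) + n ≤ n * n := by
    calc n * (j : ℕ) + n = n * ((j : ℕ) + 1) := by ring
      _ ≤ n * n := Nat.mul_le_mul_left _ h1
  rw [sq]; omega

lemma count (n k : ℕ) (hk : 1 ≤ k) (hn : 256 * k ^ 4 < n) (h : ∀ g, SdpCert (gSet n g) k) : False := by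
  have hn0 : 0 < n := by omega
  have hdata : ∀ g, ∃ p Y t, NData (gSet n g) k p Y t := fun g =>
    exists_ndata _ (Finset.card_pos.1 (by rw [gSet_card]; exact hn0)) k (h g)
  choose p Y t hD using hdata
  set Jc := Fintype.card (GenIdx k) with hJc
  have hJ : Jc = 3 + k * k := by simp [hJc]
  set R := n ^ 6 * k * Jc with hR
  have hR0 : 0 < R := by rw [hR, hJ]; positivity
  have hRr : (0 : ℝ) < R := by exact_mod_cast hR0
  have hentry : ∀ g a x y, |Y g (t g a) x y| ≤ 1 := by
    intro g a x y
    refine (ndata_entry (hD g) _ ((hD g).2.2.2.1 a) x y).trans ?_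
    cases p g x <;> cases p g y <;> simp
  let q : (Fin n → Fin n) → (GenIdx k → Fin k → Fin k → Fin (2 * R + 1)) := fun g a x y =>
    ⟨⌊(Y g (t g a) x y + 1) * R⌋₊, by
      have h1 := abs_le.1 (hentry g a x y)
      rw [Nat.lt_succ_iff]
      apply Nat.floor_le_of_le
      push_cast
      nlinarith [h1.2]⟩
  let code : (Fin n → Fin n) → (Fin k → Bool) × (GenIdx k → Fin (n ^ 2 + 1)) ×
      (GenIdx k → Fin k → Fin k → Fin (2 * R + 1)) := fun g =>
    (p g, fun a => ⟨t g a, Nat.lt_succ_of_le (gSet_bound n g _ ((hD g).2.2.2.1 a)).2⟩, q g)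
  have hinj : Function.Injective code := by
    intro g g' hg
    have hp : p g = p g' := congrArg (fun z => z.1) hg
    have ht : t g = t g' := by
      funext a
      exact congrArg (fun z => ((z.2.1 a : Fin (n ^ 2 + 1)) : ℕ)) hg
    have hq : ∀ a x y, ⌊(Y g (t g a) x y + 1) * R⌋₊ = ⌊(Y g' (t g' a) x y + 1) * R⌋₊ := by
      intro a x y
      exact congrArg (fun z => ((z.2.2 a x y : Fin (2 * R + 1)) : ℕ)) hg
    have hclose : ∀ a x y, |Y g (t g a) x y - Y g' (t g a) x y| ≤ 1 / R := by
      intro a x y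
      have h0 := hq a x y
      rw [← ht] at h0
      have b1 := abs_le.1 (hentry g a x y)
      have b2 := hentry g' a x y
      rw [← ht] at b2
      have b2 := abs_le.1 b2
      have f1 := Nat.floor_le (mul_nonneg (by linarith [b1.1] : 0 ≤ Y g (t g a) x y + 1) hRr.le)
      have f2 := Nat.floor_le (mul_nonneg (by linarith [b2.1] : 0 ≤ Y g' (t g a) x y + 1) hRr.le)
      have f3 := Nat.lt_floor_add_one ((Y g (t g a) x y + 1) * R)
      have f4 := Nat.lt_floor_add_one ((Y g' (t g a) x y + 1) * R)
      rw [h0] at f1 f3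
      rw [abs_le]
      constructor
      · rw [neg_le, le_div_iff₀ hRr]; nlinarith
      · rw [le_div_iff₀ hRr]; nlinarith
    have hD' := hD g'
    rw [← hp, ← ht] at hD'
    have hsub : gSet n g' ⊆ gSet n g := by
      refine core_s16 (hD g) hD' (1 / R) (by positivity) hclose (n ^ 2)
        (fun i hi => (gSet_bound n g i hi).2) (fun i hi => (gSet_bound n g' i hi).2) ?_
      rw [gSet_card, ← hJc, hR]
      have hn1 : (1 : ℝ) < n := by
        have : 1 < n := by nlinarith [Nat.one_le_pow 4 k hk]
        exact_mod_cast this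
      have hk1 : (0 : ℝ) < k := by exact_mod_cast hk
      have hJ1 : (0 : ℝ) < Jc := by
        have : 0 < Jc := by rw [hJ]; omega
        exact_mod_cast this
      push_cast
      have e : (k : ℝ) * (Jc * (1 / (n ^ 6 * k * Jc))) * (n * ((n : ℝ) ^ 2) ^ 2) = 1 / n := by
        field_simp
      rw [e, div_lt_one (by linarith)]
      exact hn1
    have := Finset.eq_of_subset_of_card_le hsub (by rw [gSet_card, gSet_card])
    exact gSet_inj n this.symm
  have hcard := Fintype.card_le_of_injective code hinj
  simp only [Fintype.card_prod, Fintype.card_fun, Fintype.card_fin, Fintype.card_bool] at hcard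
  rw [← hJc] at hcard
  have hk2 : k ≤ k ^ 4 := Nat.le_self_pow (by norm_num) k
  have hk3 : k ^ 2 ≤ k ^ 4 := Nat.pow_le_pow_right hk (by norm_num)
  have hk4 : k ^ 3 ≤ k ^ 4 := Nat.pow_le_pow_right hk (by norm_num)
  have hk5 : 1 ≤ k ^ 4 := Nat.one_le_pow _ _ hk
  have c1 : 2 ^ k ≤ n ^ k := Nat.pow_le_pow_left (by omega) k
  have c2 : (n ^ 2 + 1) ^ Jc ≤ n ^ (3 * Jc) := by
    rw [pow_mul]
    refine Nat.pow_le_pow_left ?_ _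
    have : 2 ≤ n := by omega
    nlinarith [Nat.one_le_pow 2 n hn0]
  have c3 : 2 * R + 1 ≤ n ^ 7 := by
    have e : 2 * R = n ^ 6 * (2 * (3 * k + k ^ 3)) := by rw [hR, hJ]; ring
    have : 2 * (3 * k + k ^ 3) + 1 ≤ n := by omega
    have h6 : 1 ≤ n ^ 6 := Nat.one_le_pow _ _ hn0
    calc 2 * R + 1 ≤ n ^ 6 * (2 * (3 * k + k ^ 3) + 1) := by
            rw [e, Nat.mul_succ]; omega
      _ ≤ n ^ 6 * n := Nat.mul_le_mul_left _ this
      _ = n ^ 7 := by ring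
  have c4 : (((2 * R + 1) ^ k) ^ k) ^ Jc ≤ n ^ (7 * (k * k * Jc)) := by
    rw [← pow_mul, ← pow_mul, pow_mul n 7, mul_assoc k k Jc]
    exact Nat.pow_le_pow_left c3 _
  have c5 : n ^ n ≤ n ^ (k + (3 * Jc + 7 * (k * k * Jc))) := by
    refine hcard.trans ?_
    rw [pow_add, pow_add]
    exact Nat.mul_le_mul c1 (Nat.mul_le_mul c2 c4)
  have c6 : k + (3 * Jc + 7 * (k * k * Jc)) < n := by
    have : k + (3 * Jc + 7 * (k * k * Jc)) = k + 9 + 24 * k ^ 2 + 7 * k ^ 4 := by rw [hJ]; ring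
    omega
  have : n ^ (k + (3 * Jc + 7 * (k * k * Jc))) < n ^ n := Nat.pow_lt_pow_right (by omega) c6
  omega

lemma small_of_lt (n k : ℕ) (h : (k : ℝ) < (n : ℝ) ^ ((1 : ℝ) / 4) / 4) : 256 * k ^ 4 < n := by
  have h1 : 4 * (k : ℝ) < (n : ℝ) ^ ((1 : ℝ) / 4) := by linarith
  have h2 : (4 * (k : ℝ)) ^ 4 < ((n : ℝ) ^ ((1 : ℝ) / 4)) ^ 4 :=
    pow_lt_pow_left₀ h1 (by positivity) (by norm_num)
  rw [← Real.rpow_natCast, ← Real.rpow_natCast, ← Real.rpow_mul (by positivity)] at h2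
  norm_num at h2
  have h3 : (4 * (k : ℝ)) ^ 4 < n := by exact_mod_cast h2
  have h4 : (256 * k ^ 4 : ℝ) < n := by nlinarith
  exact_mod_cast h4

open Classical in
theorem statement16 (n : ℕ) (hn : 2 ≤ n) :
    ∃ (P : Set (EuclideanSpace ℝ (Fin 2))) (V : Finset (EuclideanSpace ℝ (Fin 2))),
      P = convexHull ℝ (V : Set (EuclideanSpace ℝ (Fin 2))) ∧
      V.card = n ∧
      (∀ v ∈ V, v ∉ convexHull ℝ ((V.erase v : Finset (EuclideanSpace ℝ (Fin 2))) :
          Set (EuclideanSpace ℝ (Fin 2)))) ∧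
      (∀ v ∈ V, ∃ a b : ℕ, 1 ≤ a ∧ a ≤ n ^ 2 ∧ 1 ≤ b ∧ b ≤ n ^ 4 ∧
          v = (EuclideanSpace.equiv (Fin 2) ℝ).symm ![(a : ℝ), (b : ℝ)]) ∧
      (n : ℝ) ^ ((1 : ℝ) / 4) / 4 ≤ (sxc P : ℝ) := by
  by_contra hcon
  have hlt : ∀ g : Fin n → Fin n,
      (sxc (convexHull ℝ (parPt '' (gSet n g : Set ℕ))) : ℝ) < (n : ℝ) ^ ((1 : ℝ) / 4) / 4 := by
    intro g
    by_contra hge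
    apply hcon
    refine ⟨_, (gSet n g).image parPt, rfl, ?_, ?_, ?_, ?_⟩
    · rw [Finset.card_image_of_injective _ parPt_inj, gSet_card]
    · intro v hv hmem
      obtain ⟨j, hj, rfl⟩ := Finset.mem_image.1 hv
      have hsub : (((gSet n g).image parPt).erase (parPt j) : Set (EuclideanSpace ℝ (Fin 2)))
          ⊆ parPt '' {i | i ≠ j} := by
        intro q hq
        obtain ⟨h1, h2⟩ := Finset.mem_erase.1 (Finset.mem_coe.1 hq)
        obtain ⟨i, _, rfl⟩ := Finset.mem_image.1 h2
        exact ⟨i, fun e => h1 (by rw [e]), rfl⟩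
      have := halfspace {i | i ≠ j} j 1 ?_ _ (convexHull_mono hsub hmem)
      · rw [parPt_zero, parPt_one] at this
        nlinarith
      · intro i hi
        have : (1 : ℤ) ≤ ((i : ℤ) - j) ^ 2 := by
          have hi' : i ≠ j := hi
          have : (i : ℤ) - j ≠ 0 := by omega
          have := sq_pos_of_ne_zero this
          omega
        exact_mod_cast this
    · intro v hv
      obtain ⟨j, hj, rfl⟩ := Finset.mem_image.1 hv
      obtain ⟨h1, h2⟩ := gSet_bound n g j hj
      refine ⟨j, j ^ 2, h1, h2, Nat.one_le_pow _ _ h1, ?_, ?_⟩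
      · calc j ^ 2 ≤ (n ^ 2) ^ 2 := Nat.pow_le_pow_left h2 2
          _ = n ^ 4 := by ring
      · simp [parPt]
    · rw [Finset.coe_image]
      exact not_lt.1 hge
  have hex : ∀ g : Fin n → Fin n, ∃ k, SdpCert (gSet n g) k ∧ 256 * k ^ 4 < n := by
    intro g
    obtain ⟨k, hk, e⟩ := exists_cert (gSet n g) (by rw [gSet_card]; exact hn)
    refine ⟨k, hk, small_of_lt n k ?_⟩
    rw [e]; exact hlt g
  choose k hk hkn using hex
  have : Nonempty (Fin n → Fin n) := ⟨id⟩
  obtain ⟨g0, hg0⟩ := Finite.exists_max k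
  refine count n (k g0) ?_ (hkn g0) fun g => cert_mono _ (hg0 g) (hk g)
  rcases Nat.eq_zero_or_pos (k g0) with h0 | h0
  · have := hk g0
    rw [h0] at this
    exact (cert_pos _ (by rw [gSet_card]; exact hn) this).elim
  · exact h0
end
end
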